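/- arXiv:2205.12829 — 6 statements merged into one kernel-verified Lean document; each statement's English description precedes it below -/
import Mathlib

section
/- Let A, B, C, D and A', B', C', D' be integers with C, C', D, D' ≥ 1, and let Φ = Φ_{A,B,C,D}, Φ' = Φ_{A',B',C',D'} with associated rings R = R_{A,B,C,D}, R' = R_{A',B',C',D'} ⊆ Mat₂(ℤ). Then there exists U ∈ SL₃(ℤ) with Φ'(x) = Φ(U·x) for all x if and only if there exists an invertible 2×2 matrix γ with rational entries such that γ·R·γ⁻¹ = R'. -/
noncomputable section
open Filter Topology
open scoped ENNReal LinearAlgebra.Projectivization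

abbrev V3 := Fin 3 → ℝ

instance : TopologicalSpace (ℙ ℝ V3) :=
  TopologicalSpace.coinduced (Projectivization.mk' ℝ) inferInstance

/-- The ternary quadratic form `A X² + B XY + C Y² + D XZ + E YZ + F Z²` on `ℝ³`. -/
def Phi6 (A B C D E F : ℤ) (P : V3) : ℝ :=
  A * P 0 ^ 2 + B * P 0 * P 1 + C * P 1 ^ 2 + D * P 0 * P 2 + E * P 1 * P 2 + F * P 2 ^ 2

/-- The discriminant: four times the determinant of the Gram matrix. -/
def disc6 (A B C D E F : ℤ) : ℤ :=
  4 * A * C * F + B * D * E - A * E ^ 2 - C * D ^ 2 - F * B ^ 2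

/-- The bilinear form associated to a quadratic form. -/
def bil (Φ : V3 → ℝ) (P Q : V3) : ℝ := (Φ (P + Q) - Φ P - Φ Q) / 2

def intCast3 (P : Fin 3 → ℤ) : V3 := fun i => (P i : ℝ)

/-- Nonzero integer points on the conic `Φ = 0`. -/
def ConicPts (Φ : V3 → ℝ) := {P : Fin 3 → ℤ // intCast3 P ≠ 0 ∧ Φ (intCast3 P) = 0}

/-- Lagrange approximability `λ_Φ(Ξ; Σ)`: limsup of `√(Δ·|Φ(Σ)|)/|⟨Σ,P⟩|` over nonzero
integer zeros `P` of `Φ`, along the pullback of the neighborhood filter of `[Ξ]` in `ℙ²(ℝ)`. -/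
def lambdaPhi (Φ : V3 → ℝ) (Δ : ℝ) (Ξ Sg : V3) : ℝ≥0∞ :=
  if hΞ : Ξ ≠ 0 then
    Filter.limsup
      (fun P : ConicPts Φ =>
        ENNReal.ofReal (Real.sqrt (Δ * |Φ Sg|) / |bil Φ Sg (intCast3 P.1)|))
      (Filter.comap (fun P : ConicPts Φ => Projectivization.mk ℝ (intCast3 P.1) P.2.1)
        (nhds (Projectivization.mk ℝ Ξ hΞ)))
  else 0

/-- Markoff approximability `μ_Φ(Σ)`. -/
def muPhi (Φ : V3 → ℝ) (Δ : ℝ) (Sg : V3) : ℝ≥0∞ :=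
  ⨆ (P : Fin 3 → ℤ) (_ : intCast3 P ≠ 0) (_ : Φ (intCast3 P) = 0)
    (_ : bil Φ Sg (intCast3 P) ≠ 0),
    ENNReal.ofReal (Real.sqrt (Δ * |Φ Sg|) / |bil Φ Sg (intCast3 P)|)

/-- `Ξ` spans an irrational line: no nonzero integer vector is proportional to `Ξ`. -/
def IrrationalLine (Ξ : V3) : Prop :=
  ∀ P : Fin 3 → ℤ, P ≠ 0 → ∀ c : ℝ, intCast3 P ≠ c • Ξ

/-- Classical approximability of a real number. -/
def lambdaCl (ξ : ℝ) : ℝ≥0∞ :=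
  Filter.limsup (fun q : ℚ => ENNReal.ofReal (1 / ((q.den : ℝ) ^ 2 * |(q : ℝ) - ξ|)))
    (Filter.comap (fun q : ℚ => (q : ℝ)) (nhds ξ))

/-- Classical Markoff approximability of a pair of real numbers. -/
def muCl (η η' : ℝ) : ℝ≥0∞ :=
  ⨆ (st : ℤ × ℤ) (_ : st ≠ 0),
    ENNReal.ofReal (|η - η'| / |((st.1 : ℝ) - st.2 * η) * ((st.1 : ℝ) - st.2 * η')|)

/-- The `n`-Lagrange approximability. -/
def nLagrange (n : ℕ) (ξ : ℝ) : ℝ≥0∞ :=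
  Filter.limsup
    (fun q : ℚ => ENNReal.ofReal ((Nat.gcd q.den n : ℝ) / ((q.den : ℝ) ^ 2 * |(q : ℝ) - ξ|)))
    (Filter.comap (fun q : ℚ => (q : ℝ)) (nhds ξ))

/-- The `n`-Markoff approximability. -/
def nMarkoff (n : ℕ) (ξ ξ' : ℝ) : ℝ≥0∞ :=
  ⨆ (st : ℤ × ℤ) (_ : st ≠ 0),
    ENNReal.ofReal (|ξ - ξ'| * (Int.gcd st.2 (n : ℤ) : ℝ) /
      |((st.1 : ℝ) - st.2 * ξ) * ((st.1 : ℝ) - st.2 * ξ')|)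

/-- The quaternion ring `R_{A,B,C,D}` as a `ℤ`-submodule of `Mat₂(ℤ)`. -/
def Rring (A B C D : ℤ) : Submodule ℤ (Matrix (Fin 2) (Fin 2) ℤ) :=
  Submodule.span ℤ {1, !![B, C; -A, 0], !![0, 0; 0, D], !![0, 0; D, 0]}

/-- The real point of the conic `Φ_{A,B,C,D} = 0` with parameter `ξ`. -/
def XiOf (A B C D : ℤ) (ξ : ℝ) : V3 :=
  ![(D : ℝ) * ξ ^ 2, (D : ℝ) * ξ, (A : ℝ) * ξ ^ 2 + (B : ℝ) * ξ + (C : ℝ)]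

section conicRing

open Matrix

/-- Symmetric matrices are determined by their quadratic forms. -/
lemma symm_matrix_ext {n K : Type*} [Fintype n] [DecidableEq n] [Field K] [CharZero K]
    {P Q : Matrix n n K} (hP : P.IsSymm) (hQ : Q.IsSymm)
    (h : ∀ x : n → K, x ⬝ᵥ P *ᵥ x = x ⬝ᵥ Q *ᵥ x) : P = Q := by
  ext i j
  have hij := h (Pi.single i 1 + Pi.single j 1)
  have hi := h (Pi.single i 1)
  have hj := h (Pi.single j 1)
  simp only [mulVec_add, add_dotProduct, dotProduct_add, mulVec_single_one,
    single_one_dotProduct, col_apply] at hij hi hj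
  rw [hP.apply i j, hQ.apply i j] at hij
  have : (2 : K) * P i j = 2 * Q i j := by linear_combination hij - hi - hj
  exact mul_left_cancel₀ two_ne_zero this

/-- Twice the Gram matrix of `-A X² - B XY - C Y² + D XZ`. -/
def gramMat {R : Type*} [CommRing R] (A B C D : R) : Matrix (Fin 3) (Fin 3) R :=
  !![-2 * A, -B, D; -B, -2 * C, 0; D, 0, 0]

/-- The Gram matrix of the polar form of the determinant on trace-zero matrices. -/
def detGram : Matrix (Fin 3) (Fin 3) ℚ := !![-2, 0, 0; 0, 0, -1; 0, -1, 0]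

/-- The trace-zero matrix with given coordinates. -/
def traceZero (v : Fin 3 → ℚ) : Matrix (Fin 2) (Fin 2) ℚ := !![v 0, v 1; v 2, -v 0]

/-- A basis, in the coordinates of `traceZero`, of the trace-zero part of the lattice dual to
`R_{A,B,C,D}` under the trace form. -/
def dualBasis (A B C D : ℚ) : Matrix (Fin 3) (Fin 3) ℚ :=
  !![0, -1 / D, 0; 1 / D, 0, 0; A / (C * D), B / (C * D), -1 / C]

/-- The general element of `R_{A,B,C,D}`. -/
def ringElt {R : Type*} [CommRing R] (A B C D n a b c : R) : Matrix (Fin 2) (Fin 2) R :=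
  !![n + a * B, a * C; c * D - a * A, n + b * D]

/-- Conjugation by `γ` maps `R_{A,B,C,D}` into `R_{A',B',C',D'}`. -/
def Intertwines (γ : Matrix (Fin 2) (Fin 2) ℚ) (A B C D A' B' C' D' : ℤ) : Prop :=
  ∀ n a b c : ℤ, ∃ n' a' b' c' : ℤ,
    γ * ringElt (A : ℚ) B C D n a b c = ringElt (A' : ℚ) B' C' D' n' a' b' c' * γ

lemma mem_Rring {A B C D : ℤ} {M : Matrix (Fin 2) (Fin 2) ℤ} :
    M ∈ Rring A B C D ↔ ∃ n a b c : ℤ, M = ringElt A B C D n a b c := by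
  simp only [Rring, Submodule.mem_span_insert, Submodule.mem_span_singleton]
  constructor
  · rintro ⟨n, _, ⟨a, _, ⟨b, _, ⟨c, rfl⟩, rfl⟩, rfl⟩, rfl⟩
    refine ⟨n, a, b, c, ?_⟩
    ext i j
    fin_cases i <;> fin_cases j <;> simp [ringElt, one_fin_two, -zsmul_eq_mul]
    ring
  · rintro ⟨n, a, b, c, rfl⟩
    refine ⟨n, _, ⟨a, _, ⟨b, _, ⟨c, rfl⟩, rfl⟩, rfl⟩, ?_⟩
    ext i j
    fin_cases i <;> fin_cases j <;> simp [ringElt, one_fin_two, -zsmul_eq_mul]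
    ring

lemma map_ringElt (A B C D n a b c : ℤ) :
    (ringElt A B C D n a b c).map (Int.cast : ℤ → ℚ) = ringElt (A : ℚ) B C D n a b c := by
  ext i j
  fin_cases i <;> fin_cases j <;> simp [ringElt]

lemma conj_Rring_eq_iff {γ : Matrix (Fin 2) (Fin 2) ℚ} (hγ : IsUnit γ)
    (A B C D A' B' C' D' : ℤ) :
    {N : Matrix (Fin 2) (Fin 2) ℚ |
        ∃ M ∈ Rring A B C D, N = γ * M.map (Int.cast : ℤ → ℚ) * γ⁻¹} =
      {N : Matrix (Fin 2) (Fin 2) ℚ |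
        ∃ M ∈ Rring A' B' C' D', N = M.map (Int.cast : ℤ → ℚ)} ↔
    Intertwines γ A B C D A' B' C' D' ∧ Intertwines γ⁻¹ A' B' C' D' A B C D := by
  have hdet := (Matrix.isUnit_iff_isUnit_det γ).1 hγ
  have h1 := Matrix.mul_nonsing_inv γ hdet
  have h2 := Matrix.nonsing_inv_mul γ hdet
  rw [Set.Subset.antisymm_iff]
  refine and_congr ⟨fun h n a b c => ?_, fun h => ?_⟩ ⟨fun h n a b c => ?_, fun h => ?_⟩
  · obtain ⟨M, hM, hN⟩ := h ⟨_, mem_Rring.2 ⟨n, a, b, c, rfl⟩, rfl⟩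
    obtain ⟨n', a', b', c', rfl⟩ := mem_Rring.1 hM
    rw [map_ringElt, map_ringElt] at hN
    exact ⟨n', a', b', c', by rw [← hN, Matrix.mul_assoc, h2, Matrix.mul_one]⟩
  · rintro _ ⟨M, hM, rfl⟩
    obtain ⟨n, a, b, c, rfl⟩ := mem_Rring.1 hM
    obtain ⟨n', a', b', c', e⟩ := h n a b c
    refine ⟨_, mem_Rring.2 ⟨n', a', b', c', rfl⟩, ?_⟩
    rw [map_ringElt, map_ringElt, e, Matrix.mul_assoc, h1, Matrix.mul_one]
  · obtain ⟨M, hM, hN⟩ := h ⟨_, mem_Rring.2 ⟨n, a, b, c, rfl⟩, rfl⟩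
    obtain ⟨n', a', b', c', rfl⟩ := mem_Rring.1 hM
    rw [map_ringElt, map_ringElt] at hN
    exact ⟨n', a', b', c', by
      rw [hN, ← Matrix.mul_assoc, ← Matrix.mul_assoc, h2, Matrix.one_mul]⟩
  · rintro _ ⟨M, hM, rfl⟩
    obtain ⟨n, a, b, c, rfl⟩ := mem_Rring.1 hM
    obtain ⟨n', a', b', c', e⟩ := h n a b c
    refine ⟨_, mem_Rring.2 ⟨n', a', b', c', rfl⟩, ?_⟩
    rw [map_ringElt, map_ringElt, Matrix.mul_assoc, ← e, ← Matrix.mul_assoc, h1, Matrix.one_mul]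

lemma gramMat_isSymm {R : Type*} [CommRing R] (A B C D : R) : (gramMat A B C D).IsSymm := by
  ext i j
  fin_cases i <;> fin_cases j <;> simp [gramMat]

lemma map_gramMat {R : Type*} [CommRing R] (A B C D : ℤ) :
    (gramMat A B C D).map (Int.cast : ℤ → R) = gramMat (A : R) B C D := by
  ext i j
  fin_cases i <;> fin_cases j <;> simp [gramMat]

lemma det_gramMat {R : Type*} [CommRing R] (A B C D : R) :
    (gramMat A B C D).det = 2 * (C * D ^ 2) := by
  simp [gramMat, det_fin_three]
  ring

lemma two_mul_Phi6 (A B C D : ℤ) (x : V3) :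
    2 * Phi6 (-A) (-B) (-C) D 0 0 x = x ⬝ᵥ gramMat (A : ℝ) B C D *ᵥ x := by
  simp [Phi6, gramMat, dotProduct, mulVec, Fin.sum_univ_three]
  ring

lemma dotProduct_congr_mulVec {n R : Type*} [Fintype n] [CommRing R] (G U : Matrix n n R)
    (x : n → R) : (U *ᵥ x) ⬝ᵥ G *ᵥ (U *ᵥ x) = x ⬝ᵥ (Uᵀ * G * U) *ᵥ x := by
  rw [← mulVec_mulVec, ← mulVec_mulVec, dotProduct_mulVec x Uᵀ, vecMul_transpose]

lemma isSymm_congr {n R : Type*} [Fintype n] [CommRing R] {G : Matrix n n R} (hG : G.IsSymm)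
    (U : Matrix n n R) : (Uᵀ * G * U).IsSymm := by
  simp [IsSymm, transpose_mul, hG.eq, Matrix.mul_assoc]

lemma map_congr_gramMat {R : Type*} [CommRing R] (A B C D : ℤ) (U : Matrix (Fin 3) (Fin 3) ℤ) :
    (Uᵀ * gramMat A B C D * U).map (Int.cast : ℤ → R) =
      (U.map (Int.cast : ℤ → R))ᵀ * gramMat (A : R) B C D * U.map (Int.cast : ℤ → R) := by
  rw [← map_gramMat]
  ext i j
  simp [mul_apply]

lemma forall_Phi6_eq_iff (A B C D A' B' C' D' : ℤ) (U : Matrix (Fin 3) (Fin 3) ℤ) :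
    (∀ x : V3, Phi6 (-A') (-B') (-C') D' 0 0 x =
      Phi6 (-A) (-B) (-C) D 0 0 ((U.map (Int.cast : ℤ → ℝ)).mulVec x)) ↔
    Uᵀ * gramMat A B C D * U = gramMat A' B' C' D' := by
  have key : ∀ x : V3, (Phi6 (-A') (-B') (-C') D' 0 0 x =
      Phi6 (-A) (-B) (-C) D 0 0 ((U.map (Int.cast : ℤ → ℝ)).mulVec x)) ↔
      x ⬝ᵥ (Uᵀ * gramMat A B C D * U).map (Int.cast : ℤ → ℝ) *ᵥ x =
        x ⬝ᵥ (gramMat A' B' C' D').map (Int.cast : ℤ → ℝ) *ᵥ x := fun x => by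
    rw [map_congr_gramMat, map_gramMat, ← dotProduct_congr_mulVec, ← two_mul_Phi6, ← two_mul_Phi6]
    exact ⟨fun h => by rw [h], fun h => by linarith⟩
  simp only [key]
  refine ⟨fun h => ?_, fun h x => by rw [h]⟩
  refine Matrix.map_injective (Int.cast_injective (α := ℝ)) (symm_matrix_ext ?_ ?_ h)
  · exact (isSymm_congr (gramMat_isSymm ..) U).map _
  · exact (gramMat_isSymm ..).map _

lemma dualBasis_congr {A B C D : ℚ} (hC : C ≠ 0) (hD : D ≠ 0) :
    (C * D ^ 2) • ((dualBasis A B C D)ᵀ * detGram * dualBasis A B C D) = gramMat A B C D := by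
  ext i j
  fin_cases i <;> fin_cases j <;>
    simp [dualBasis, detGram, gramMat, mul_apply, Fin.sum_univ_three] <;> field_simp
  ring

lemma det_dualBasis {A B C D : ℚ} (hC : C ≠ 0) (hD : D ≠ 0) :
    (dualBasis A B C D).det = -(C * D ^ 2)⁻¹ := by
  simp [dualBasis, det_fin_three]
  field_simp

lemma two_mul_det_traceZero (v : Fin 3 → ℚ) :
    2 * (traceZero v).det = v ⬝ᵥ detGram *ᵥ v := by
  simp [traceZero, detGram, dotProduct, mulVec, Fin.sum_univ_three, det_fin_two]
  ring

lemma detGram_isSymm : detGram.IsSymm := by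
  ext i j
  fin_cases i <;> fin_cases j <;> simp [detGram]

/-- A proper isometry of the trace-zero matrices is a conjugation. -/
lemma exists_conj_of_isometry {O : Matrix (Fin 3) (Fin 3) ℚ}
    (hO : Oᵀ * detGram * O = detGram) (hdet : O.det = 1) :
    ∃ γ : Matrix (Fin 2) (Fin 2) ℚ, IsUnit γ ∧
      ∀ v, γ * traceZero v = traceZero (O *ᵥ v) * γ := by
  have hadj : detGram * O.adjugate = Oᵀ * detGram := by
    calc detGram * O.adjugate = Oᵀ * detGram * O * O.adjugate := by rw [hO]
      _ = Oᵀ * detGram := by rw [Matrix.mul_assoc _ O, mul_adjugate, hdet, one_smul, Matrix.mul_one]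
  have g11 := congrFun₂ hO 1 1
  have g22 := congrFun₂ hO 2 2
  have g12 := congrFun₂ hO 1 2
  have a0 := congrFun₂ hadj 0 0
  have a1 := congrFun₂ hadj 0 1
  have a2 := congrFun₂ hadj 0 2
  simp [detGram, mul_apply, Fin.sum_univ_three, adjugate_fin_three]
    at g11 g22 g12 a0 a1 a2
  have intertwine : ∀ x y : ℚ, ∀ v : Fin 3 → ℚ,
      let g := !![O 0 1 * x + O 1 1 * y; O 2 1 * x - O 0 1 * y]
      let γ := !![g 0 0, O 0 2 * g 0 0 + O 1 2 * g 1 0; g 1 0, O 2 2 * g 0 0 - O 0 2 * g 1 0]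
      γ * traceZero v = traceZero (O *ᵥ v) * γ := by
    intro x y v
    ext i j
    fin_cases i <;> fin_cases j <;>
      simp [traceZero, mul_apply, mulVec, dotProduct, Fin.sum_univ_three] <;> grind
  have hpol : 2 * O 0 1 * O 0 2 + O 1 1 * O 2 2 + O 2 1 * O 1 2 = 1 := by grind
  by_cases hr : O 2 1 = 0
  · have hp : O 0 1 = 0 := by
      rw [hr] at g11
      exact pow_eq_zero_iff two_ne_zero |>.1 (by linear_combination -g11 / 2)
    have hq : O 1 1 ≠ 0 := by
      intro hq
      simp [hr, hp, hq] at hpol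
    refine ⟨_, ?_, intertwine 0 1⟩
    rw [Matrix.isUnit_iff_isUnit_det, isUnit_iff_ne_zero]
    convert hq using 1
    simp [det_fin_two]
    grind
  · refine ⟨_, ?_, intertwine 1 0⟩
    rw [Matrix.isUnit_iff_isUnit_det, isUnit_iff_ne_zero]
    convert neg_ne_zero.2 hr using 1
    simp [det_fin_two]
    grind

lemma isUnit_nonsing_inv {γ : Matrix (Fin 2) (Fin 2) ℚ} (hγ : IsUnit γ) : IsUnit γ⁻¹ := by
  rwa [Matrix.isUnit_nonsing_inv_iff]

lemma inv_mul_traceZero {γ : Matrix (Fin 2) (Fin 2) ℚ} (hγ : IsUnit γ)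
    {K L : Matrix (Fin 3) (Fin 3) ℚ} (U V : Matrix (Fin 3) (Fin 3) ℤ) (hUV : U * V = 1)
    (h : ∀ x, γ * traceZero (K *ᵥ x) = traceZero (L *ᵥ (U.map (Int.cast : ℤ → ℚ) *ᵥ x)) * γ)
    (x : Fin 3 → ℚ) :
    γ⁻¹ * traceZero (L *ᵥ x) = traceZero (K *ᵥ (V.map (Int.cast : ℤ → ℚ) *ᵥ x)) * γ⁻¹ := by
  have hdet := (Matrix.isUnit_iff_isUnit_det γ).1 hγ
  have hUV' : U.map (Int.cast : ℤ → ℚ) * V.map (Int.cast : ℤ → ℚ) = 1 := by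
    have := congrArg (Int.castRingHom ℚ).mapMatrix hUV
    rwa [map_mul, map_one] at this
  have := h (V.map (Int.cast : ℤ → ℚ) *ᵥ x)
  rw [mulVec_mulVec x (U.map _), hUV', one_mulVec] at this
  rw [← Matrix.mul_one (traceZero (L *ᵥ x)), ← Matrix.mul_nonsing_inv γ hdet,
    ← Matrix.mul_assoc (traceZero _), ← this, Matrix.mul_assoc, ← Matrix.mul_assoc γ⁻¹,
    Matrix.nonsing_inv_mul γ hdet, Matrix.one_mul]

/-- Products of elements of the dual basis, scaled by the discriminant, lie in the ring. -/
lemma smul_traceZero_mul_traceZero {A B C D : ℚ} (hC : C ≠ 0) (hD : D ≠ 0) (x y : Fin 3 → ℚ) :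
    (C * D ^ 2) • (traceZero (dualBasis A B C D *ᵥ x) * traceZero (dualBasis A B C D *ᵥ y)) =
      ringElt A B C D
        (C * x 1 * y 1 + x 0 * (A * y 0 + B * y 1 - D * y 2) - B * (x 0 * y 1 - x 1 * y 0))
        (x 0 * y 1 - x 1 * y 0) (x 0 * y 2 - x 2 * y 0) (x 2 * y 1 - x 1 * y 2) := by
  ext i j
  fin_cases i <;> fin_cases j <;>
    simp [dualBasis, traceZero, ringElt, mulVec, dotProduct, Fin.sum_univ_three] <;>
    field_simp <;> ring

lemma intertwines_of_traceZero {A B C D A' B' C' D' : ℤ}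
    (hC : C ≠ 0) (hD : D ≠ 0) (hC' : C' ≠ 0) (hD' : D' ≠ 0) (hN : C * D ^ 2 = C' * D' ^ 2)
    {γ : Matrix (Fin 2) (Fin 2) ℚ} (U : Matrix (Fin 3) (Fin 3) ℤ)
    (h : ∀ x, γ * traceZero (dualBasis (A : ℚ) B C D *ᵥ x) =
      traceZero (dualBasis (A' : ℚ) B' C' D' *ᵥ (U.map (Int.cast : ℤ → ℚ) *ᵥ x)) * γ) :
    Intertwines γ A B C D A' B' C' D' := by
  have hN' : (C : ℚ) * D ^ 2 = C' * D' ^ 2 := mod_cast hN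
  have hprod : ∀ x y : Fin 3 → ℤ, ∃ n' a' b' c' : ℤ,
      γ * ((C * D ^ 2 : ℚ) • (traceZero (dualBasis (A : ℚ) B C D *ᵥ fun i => x i) *
        traceZero (dualBasis (A : ℚ) B C D *ᵥ fun i => y i))) =
      ringElt (A' : ℚ) B' C' D' n' a' b' c' * γ := by
    intro x y
    have hcast : ∀ z : Fin 3 → ℤ, U.map (Int.cast : ℤ → ℚ) *ᵥ (fun i => (z i : ℚ)) =
        fun i => ((U *ᵥ z) i : ℚ) := by
      intro z
      ext i
      simp [mulVec, dotProduct]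
    rw [Matrix.mul_smul, ← Matrix.mul_assoc, h, Matrix.mul_assoc, h, ← Matrix.mul_assoc, hN',
      ← Matrix.smul_mul, smul_traceZero_mul_traceZero (mod_cast hC') (mod_cast hD'),
      hcast, hcast]
    generalize U *ᵥ x = x
    generalize U *ᵥ y = y
    refine ⟨C' * x 1 * y 1 + x 0 * (A' * y 0 + B' * y 1 - D' * y 2) -
        B' * (x 0 * y 1 - x 1 * y 0), x 0 * y 1 - x 1 * y 0, x 0 * y 2 - x 2 * y 0,
      x 2 * y 1 - x 1 * y 2, ?_⟩
    push_cast
    rfl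
  intro n a b c
  obtain ⟨n₁, a₁, b₁, c₁, h₁⟩ := hprod ![1, 0, 0] ![0, 1, 0]
  obtain ⟨n₂, a₂, b₂, c₂, h₂⟩ := hprod ![0, 0, 1] ![1, 0, 0]
  obtain ⟨n₃, a₃, b₃, c₃, h₃⟩ := hprod ![0, 0, 1] ![0, 1, 0]
  rw [smul_traceZero_mul_traceZero (mod_cast hC) (mod_cast hD)] at h₁ h₂ h₃
  simp at h₁ h₂ h₃
  refine ⟨n + a * n₁ - b * n₂ + c * n₃, a * a₁ - b * a₂ + c * a₃, a * b₁ - b * b₂ + c * b₃,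
    a * c₁ - b * c₂ + c * c₃, ?_⟩
  have hl : ringElt (A : ℚ) B C D n a b c = (n : ℚ) • 1 + (a : ℚ) • ringElt (A : ℚ) B C D 0 1 0 0
      - (b : ℚ) • ringElt (A : ℚ) B C D 0 0 (-1) 0 + (c : ℚ) • ringElt (A : ℚ) B C D 0 0 0 1 := by
    ext i j
    fin_cases i <;> fin_cases j <;> simp [ringElt]
    ring
  have hr : ringElt (A' : ℚ) B' C' D' (n + a * n₁ - b * n₂ + c * n₃ : ℤ)
      (a * a₁ - b * a₂ + c * a₃ : ℤ) (a * b₁ - b * b₂ + c * b₃ : ℤ)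
      (a * c₁ - b * c₂ + c * c₃ : ℤ) =
      (n : ℚ) • 1 + (a : ℚ) • ringElt (A' : ℚ) B' C' D' n₁ a₁ b₁ c₁
      - (b : ℚ) • ringElt (A' : ℚ) B' C' D' n₂ a₂ b₂ c₂
      + (c : ℚ) • ringElt (A' : ℚ) B' C' D' n₃ a₃ b₃ c₃ := by
    ext i j
    fin_cases i <;> fin_cases j <;> simp [ringElt] <;> ring
  rw [hl, hr]
  simp only [Matrix.mul_add, Matrix.mul_sub, Matrix.add_mul, Matrix.sub_mul, Matrix.mul_smul,
    Matrix.smul_mul, h₁, h₂, h₃, Matrix.mul_one, Matrix.one_mul]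

/-- A trace-zero matrix is determined by its traces against the generators of the ring. -/
lemma eq_traceZero_of_trace {A B C D : ℚ} (hC : C ≠ 0) (hD : D ≠ 0)
    {M : Matrix (Fin 2) (Fin 2) ℚ} (h0 : M.trace = 0) :
    M = traceZero (dualBasis A B C D *ᵥ ![(M * ringElt A B C D 0 0 0 1).trace,
      (M * ringElt A B C D 0 0 1 0).trace, -(M * ringElt A B C D 0 1 0 0).trace]) := by
  have h1 : M 1 1 = -M 0 0 := by rw [trace_fin_two] at h0; linarith
  ext i j
  fin_cases i <;> fin_cases j <;>
    simp [dualBasis, traceZero, ringElt, mul_apply, trace_fin_two, h1] <;> field_simp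
  ring

lemma trace_traceZero_mul_ringElt {A B C D : ℚ} (hC : C ≠ 0) (hD : D ≠ 0) (n a b c : ℚ)
    (x : Fin 3 → ℚ) :
    (traceZero (dualBasis A B C D *ᵥ x) * ringElt A B C D n a b c).trace =
      c * x 0 + b * x 1 - a * x 2 := by
  simp [dualBasis, traceZero, ringElt, trace_fin_two, mulVec, dotProduct,
    Fin.sum_univ_three]
  field_simp
  ring

lemma trace_traceZero (v : Fin 3 → ℚ) : (traceZero v).trace = 0 := by
  simp [traceZero, trace_fin_two]

lemma Intertwines.exists_traceZero {A B C D A' B' C' D' : ℤ}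
    (hC : C ≠ 0) (hD : D ≠ 0) (hC' : C' ≠ 0) (hD' : D' ≠ 0)
    {γ : Matrix (Fin 2) (Fin 2) ℚ} (hγ : IsUnit γ) (h : Intertwines γ A B C D A' B' C' D') :
    ∃ W : Matrix (Fin 3) (Fin 3) ℤ, ∀ x,
      γ * traceZero (dualBasis (A : ℚ) B C D *ᵥ (W.map (Int.cast : ℤ → ℚ) *ᵥ x)) =
        traceZero (dualBasis (A' : ℚ) B' C' D' *ᵥ x) * γ := by
  have hdet := (Matrix.isUnit_iff_isUnit_det γ).1 hγ
  obtain ⟨n₁, a₁, b₁, c₁, h₁⟩ := h 0 1 0 0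
  obtain ⟨n₂, a₂, b₂, c₂, h₂⟩ := h 0 0 1 0
  obtain ⟨n₃, a₃, b₃, c₃, h₃⟩ := h 0 0 0 1
  refine ⟨!![c₃, b₃, -a₃; c₂, b₂, -a₂; -c₁, -b₁, a₁], fun x => ?_⟩
  set S := traceZero (dualBasis (A' : ℚ) B' C' D' *ᵥ x) with hS
  have htr : ∀ {X Y : Matrix (Fin 2) (Fin 2) ℚ}, γ * X = Y * γ →
      (γ⁻¹ * S * γ * X).trace = (S * Y).trace := fun {X Y} e => by
    rw [Matrix.mul_assoc, e, Matrix.mul_assoc, trace_mul_comm, Matrix.mul_assoc,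
      Matrix.mul_assoc, Matrix.mul_nonsing_inv γ hdet, Matrix.mul_one]
  have h0 : (γ⁻¹ * S * γ).trace = 0 := by
    simpa [hS, trace_traceZero] using htr (X := 1) (Y := 1) (by simp)
  have hM := eq_traceZero_of_trace (A := A) (B := B) (C := C) (D := D)
    (mod_cast hC) (mod_cast hD) h0
  push_cast at h₁ h₂ h₃
  rw [htr h₁, htr h₂, htr h₃, hS, trace_traceZero_mul_ringElt (mod_cast hC') (mod_cast hD'),
    trace_traceZero_mul_ringElt (mod_cast hC') (mod_cast hD'),
    trace_traceZero_mul_ringElt (mod_cast hC') (mod_cast hD'), ← hS] at hM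
  have hW : (!![c₃, b₃, -a₃; c₂, b₂, -a₂; -c₁, -b₁, a₁]).map (Int.cast : ℤ → ℚ) *ᵥ x =
      ![c₃ * x 0 + b₃ * x 1 - a₃ * x 2, c₂ * x 0 + b₂ * x 1 - a₂ * x 2,
        -(c₁ * x 0 + b₁ * x 1 - a₁ * x 2)] := by
    ext i
    fin_cases i <;> simp [mulVec, dotProduct, Fin.sum_univ_three] <;> ring
  rw [hW, ← hM, ← Matrix.mul_assoc, ← Matrix.mul_assoc, Matrix.mul_nonsing_inv γ hdet,
    Matrix.one_mul]

lemma det_eq_of_intertwine {γ X Y : Matrix (Fin 2) (Fin 2) ℚ} (hγ : IsUnit γ)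
    (h : γ * X = Y * γ) : X.det = Y.det := by
  have hdet := ((Matrix.isUnit_iff_isUnit_det γ).1 hγ).ne_zero
  have := congrArg det h
  rw [det_mul, det_mul, mul_comm] at this
  exact mul_right_cancel₀ hdet this

lemma Intertwines.exists_gramMat {A B C D A' B' C' D' : ℤ}
    (hC : C ≠ 0) (hD : D ≠ 0) (hC' : C' ≠ 0) (hD' : D' ≠ 0)
    {γ : Matrix (Fin 2) (Fin 2) ℚ} (hγ : IsUnit γ) (h : Intertwines γ A B C D A' B' C' D') :
    ∃ W : Matrix (Fin 3) (Fin 3) ℤ,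
      (C' * D' ^ 2) • (Wᵀ * gramMat A B C D * W) = (C * D ^ 2) • gramMat A' B' C' D' := by
  obtain ⟨W, hW⟩ := h.exists_traceZero hC hD hC' hD' hγ
  refine ⟨W, Matrix.map_injective (Int.cast_injective (α := ℚ)) ?_⟩
  set K := dualBasis (A : ℚ) B C D with hK
  set K' := dualBasis (A' : ℚ) B' C' D' with hK'
  set W' := W.map (Int.cast : ℤ → ℚ) with hW'
  have key : (K * W')ᵀ * detGram * (K * W') = K'ᵀ * detGram * K' := by
    refine symm_matrix_ext (isSymm_congr detGram_isSymm _) (isSymm_congr detGram_isSymm _) ?_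
    intro x
    rw [← dotProduct_congr_mulVec, ← dotProduct_congr_mulVec, ← two_mul_det_traceZero,
      ← two_mul_det_traceZero, ← mulVec_mulVec, det_eq_of_intertwine hγ (hW x)]
  have e1 : ((C' * D' ^ 2) • (Wᵀ * gramMat A B C D * W)).map (Int.cast : ℤ → ℚ) =
      (C' * D' ^ 2 : ℚ) • (W'ᵀ * gramMat (A : ℚ) B C D * W') := by
    rw [hW', ← map_congr_gramMat]
    ext i j
    simp only [map_apply, Matrix.smul_apply, smul_eq_mul]
    push_cast
    rfl
  have e2 : ((C * D ^ 2) • gramMat A' B' C' D').map (Int.cast : ℤ → ℚ) =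
      (C * D ^ 2 : ℚ) • gramMat (A' : ℚ) B' C' D' := by
    rw [← map_gramMat]
    ext i j
    simp only [map_apply, Matrix.smul_apply, smul_eq_mul]
    push_cast
    rfl
  dsimp only
  rw [e1, e2, ← dualBasis_congr (mod_cast hC) (mod_cast hD),
    ← dualBasis_congr (A := A') (mod_cast hC') (mod_cast hD'), ← hK, ← hK', ← key, transpose_mul,
    Matrix.mul_smul, Matrix.smul_mul, smul_smul, smul_smul, mul_comm]
  simp only [Matrix.mul_assoc]

lemma exists_det_eq_one_of_intertwines {A B C D A' B' C' D' : ℤ}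
    (hC : 1 ≤ C) (hD : 1 ≤ D) (hC' : 1 ≤ C') (hD' : 1 ≤ D')
    {γ : Matrix (Fin 2) (Fin 2) ℚ} (hγ : IsUnit γ) (h : Intertwines γ A B C D A' B' C' D')
    (h' : Intertwines γ⁻¹ A' B' C' D' A B C D) :
    ∃ U : Matrix (Fin 3) (Fin 3) ℤ,
      U.det = 1 ∧ Uᵀ * gramMat A B C D * U = gramMat A' B' C' D' := by
  obtain ⟨W, hW⟩ := h.exists_gramMat (by lia) (by lia) (by lia) (by lia) hγ
  obtain ⟨V, hV⟩ := h'.exists_gramMat (by lia) (by lia) (by lia) (by lia) (isUnit_nonsing_inv hγ)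
  have hN : 0 < C * D ^ 2 := by positivity
  have hN' : 0 < C' * D' ^ 2 := by positivity
  have dW := congrArg det hW
  have dV := congrArg det hV
  simp only [det_smul, det_mul, det_transpose, det_gramMat, Fintype.card_fin] at dW dV
  generalize C * D ^ 2 = N at *
  generalize C' * D' ^ 2 = N' at *
  have eW : (N' * W.det) ^ 2 = N ^ 2 := by
    refine mul_left_cancel₀ (by positivity : 2 * N * N' ≠ 0) ?_
    linear_combination dW
  have eV : (N * V.det) ^ 2 = N' ^ 2 := by
    refine mul_left_cancel₀ (by positivity : 2 * N * N' ≠ 0) ?_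
    linear_combination dV
  have d1 : N' ∣ N := (Int.pow_dvd_pow_iff two_ne_zero).1 (eW ▸ pow_dvd_pow_of_dvd ⟨_, rfl⟩ 2)
  have d2 : N ∣ N' := (Int.pow_dvd_pow_iff two_ne_zero).1 (eV ▸ pow_dvd_pow_of_dvd ⟨_, rfl⟩ 2)
  obtain rfl : N = N' := Int.dvd_antisymm hN.le hN'.le d2 d1
  have hG : Wᵀ * gramMat A B C D * W = gramMat A' B' C' D' := smul_right_injective _ hN.ne' hW
  have hdet : W.det ^ 2 = 1 := by
    rw [mul_pow] at eW
    exact mul_left_cancel₀ (by positivity : N ^ 2 ≠ 0) (by rw [eW, mul_one])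
  rcases sq_eq_sq_iff_eq_or_eq_neg.1 (hdet.trans (one_pow 2).symm) with hd | hd
  · exact ⟨W, hd, hG⟩
  · exact ⟨-W, by simp [det_neg, hd], by simpa using hG⟩

lemma exists_intertwines_of_det_eq_one {A B C D A' B' C' D' : ℤ}
    (hC : C ≠ 0) (hD : D ≠ 0) (hC' : C' ≠ 0) (hD' : D' ≠ 0)
    {U : Matrix (Fin 3) (Fin 3) ℤ} (hdet : U.det = 1)
    (hU : Uᵀ * gramMat A B C D * U = gramMat A' B' C' D') :
    ∃ γ : Matrix (Fin 2) (Fin 2) ℚ, IsUnit γ ∧ Intertwines γ A B C D A' B' C' D' ∧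
      Intertwines γ⁻¹ A' B' C' D' A B C D := by
  have hN : C * D ^ 2 = C' * D' ^ 2 := by
    have := congrArg det hU
    simp only [det_mul, det_transpose, hdet, det_gramMat] at this
    linarith
  have hNq : (C : ℚ) * D ^ 2 = C' * D' ^ 2 := mod_cast hN
  have hN0 : (C : ℚ) * D ^ 2 ≠ 0 := mod_cast mul_ne_zero hC (pow_ne_zero 2 hD)
  set K := dualBasis (A : ℚ) B C D with hK
  set K' := dualBasis (A' : ℚ) B' C' D' with hK'
  have hKdet : K.det = -(C * D ^ 2 : ℚ)⁻¹ := det_dualBasis (mod_cast hC) (mod_cast hD)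
  have hKdet' : K'.det = -(C * D ^ 2 : ℚ)⁻¹ :=
    hNq ▸ det_dualBasis (mod_cast hC') (mod_cast hD')
  have hKu : IsUnit K'.det := by
    rw [hKdet']
    exact (neg_ne_zero.2 (inv_ne_zero hN0)).isUnit
  set U' := U.map (Int.cast : ℤ → ℚ) with hU'
  have hUdet : U'.det = 1 := by
    simpa [hdet] using ((Int.castRingHom ℚ).map_det U).symm
  have hUq : U'ᵀ * gramMat (A : ℚ) B C D * U' = gramMat (A' : ℚ) B' C' D' := by
    rw [hU', ← map_congr_gramMat, hU, map_gramMat]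
  have hKU : (K * U')ᵀ * detGram * (K * U') = K'ᵀ * detGram * K' := by
    refine smul_right_injective _ hN0 ?_
    dsimp only
    rw [hNq, dualBasis_congr (mod_cast hC') (mod_cast hD'), ← hUq,
      ← dualBasis_congr (A := A) (mod_cast hC) (mod_cast hD), ← hNq, transpose_mul,
      Matrix.mul_smul, Matrix.smul_mul]
    simp only [Matrix.mul_assoc, ← hK]
  obtain ⟨γ, hγ, h⟩ := exists_conj_of_isometry (O := K * U' * K'⁻¹) (by
    rw [transpose_mul, Matrix.mul_assoc, Matrix.mul_assoc, ← Matrix.mul_assoc detGram,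
      ← Matrix.mul_assoc (K * U')ᵀ, ← Matrix.mul_assoc (K * U')ᵀ, hKU, Matrix.mul_assoc,
      Matrix.mul_nonsing_inv K' hKu, Matrix.mul_one, ← Matrix.mul_assoc, ← transpose_mul,
      Matrix.mul_nonsing_inv K' hKu, transpose_one, Matrix.one_mul]) (by
    rw [det_mul, det_mul, hUdet, mul_one, det_nonsing_inv, hKdet, ← hKdet',
      Ring.mul_inverse_cancel _ hKu])
  have hγ' : ∀ x, γ * traceZero (K' *ᵥ x) = traceZero (K *ᵥ (U' *ᵥ x)) * γ := by
    intro x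
    rw [h, mulVec_mulVec, Matrix.mul_assoc, Matrix.nonsing_inv_mul K' hKu, Matrix.mul_one,
      mulVec_mulVec]
  refine ⟨γ⁻¹, isUnit_nonsing_inv hγ, ?_, ?_⟩
  · exact intertwines_of_traceZero hC hD hC' hD' hN U.adjugate
      (inv_mul_traceZero hγ _ _ (by rw [mul_adjugate, hdet, one_smul]) hγ')
  · rw [Matrix.nonsing_inv_nonsing_inv _ ((Matrix.isUnit_iff_isUnit_det γ).1 hγ)]
    exact intertwines_of_traceZero hC' hD' hC hD hN.symm U hγ'

end conicRing

/-- Proposition 3.1: two standard conics are `SL₃(ℤ)`-equivalent if and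
only if the associated quaternion rings are conjugate by an element of `GL₂(ℚ)`. -/
theorem stmt9 (A B C D A' B' C' D' : ℤ)
    (hC : 1 ≤ C) (hD : 1 ≤ D) (hC' : 1 ≤ C') (hD' : 1 ≤ D') :
    (∃ U : Matrix.SpecialLinearGroup (Fin 3) ℤ,
        ∀ x : V3, Phi6 (-A') (-B') (-C') D' 0 0 x =
          Phi6 (-A) (-B) (-C) D 0 0
            (((U : Matrix (Fin 3) (Fin 3) ℤ).map (Int.cast : ℤ → ℝ)).mulVec x)) ↔
    (∃ γ : Matrix (Fin 2) (Fin 2) ℚ, IsUnit γ ∧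
        {N : Matrix (Fin 2) (Fin 2) ℚ |
            ∃ M ∈ Rring A B C D, N = γ * M.map (Int.cast : ℤ → ℚ) * γ⁻¹} =
          {N : Matrix (Fin 2) (Fin 2) ℚ |
            ∃ M ∈ Rring A' B' C' D', N = M.map (Int.cast : ℤ → ℚ)}) := by
  simp only [forall_Phi6_eq_iff]
  constructor
  · rintro ⟨U, hU⟩
    obtain ⟨γ, hγ, h⟩ :=
      exists_intertwines_of_det_eq_one (by lia) (by lia) (by lia) (by lia) U.2 hU
    exact ⟨γ, hγ, (conj_Rring_eq_iff hγ ..).2 h⟩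
  · rintro ⟨γ, hγ, h⟩
    obtain ⟨h₁, h₂⟩ := (conj_Rring_eq_iff hγ ..).1 h
    obtain ⟨U, hdet, hU⟩ := exists_det_eq_one_of_intertwines hC hD hC' hD' hγ h₁ h₂
    exact ⟨⟨U, hdet⟩, hU⟩

end
end

section
/- Let A, B, C, D be integers with C ≥ 1 and D ≥ 1, and let Φ = Φ_{A,B,C,D}. The map ρ sending [S : T] ∈ ℙ¹(ℚ) to [D·S² : D·S·T : A·S² + B·S·T + C·T²] ∈ ℙ²(ℚ) is well defined (the image vector is nonzero and depends only on the projective class of (S,T)), its image satisfies Φ = 0, and ρ is a bijection from ℙ¹(ℚ) onto the set of rational points {[P] ∈ ℙ²(ℚ) : Φ(P) = 0} of the conic Φ = 0. -/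
noncomputable section
open scoped LinearAlgebra.Projectivization

/-- The ternary quadratic form `Φ_{A,B,C,D} = -A X² - B XY - C Y² + D XZ` over `ℚ`. -/
def PhiQ (A B C D : ℤ) (P : Fin 3 → ℚ) : ℚ :=
  -(A : ℚ) * P 0 ^ 2 - (B : ℚ) * P 0 * P 1 - (C : ℚ) * P 1 ^ 2 + (D : ℚ) * P 0 * P 2

/-- The vector `(d s², d s t, a s² + b s t + c t²)` parametrizing the conic
`d x z = a x² + b x y + c y²`. -/
def conicVec {K : Type*} [Field K] (a b c d : K) (v : Fin 2 → K) : Fin 3 → K :=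
  ![d * v 0 ^ 2, d * v 0 * v 1, a * v 0 ^ 2 + b * v 0 * v 1 + c * v 1 ^ 2]

section ConicVec

variable {K : Type*} [Field K] {a b c d : K}

theorem conicVec_smul (r : K) (v : Fin 2 → K) :
    conicVec a b c d (r • v) = r ^ 2 • conicVec a b c d v := by
  ext i
  fin_cases i <;> simp [conicVec] <;> ring

theorem conicVec_ne_zero (hc : c ≠ 0) (hd : d ≠ 0) {v : Fin 2 → K} (hv : v ≠ 0) :
    conicVec a b c d v ≠ 0 := by
  intro h
  have h0 : v 0 = 0 := by simpa [conicVec, hd] using congrFun h 0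
  have h1 : v 1 = 0 := by simpa [conicVec, hc, h0] using congrFun h 2
  exact hv (by ext i; fin_cases i <;> simp [h0, h1])

theorem exists_smul_eq_of_mul_eq_mul {v w : Fin 2 → K} (hw : w ≠ 0)
    (h : v 0 * w 1 = v 1 * w 0) : ∃ r : K, r • w = v := by
  by_cases h0 : w 0 = 0
  · have h1 : w 1 ≠ 0 := fun h1 => hw (by ext i; fin_cases i <;> simp [h0, h1])
    have hv : v 0 = 0 := by simpa [h0, h1] using h
    exact ⟨v 1 / w 1, by ext i; fin_cases i <;> simp [h0, h1, hv]⟩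
  · refine ⟨v 0 / w 0, ?_⟩
    ext i
    fin_cases i
    · simp [h0]
    · simp only [Fin.mk_one, Pi.smul_apply, smul_eq_mul]
      rw [div_mul_eq_mul_div, h, mul_div_cancel_right₀ _ h0]

theorem exists_smul_eq_of_smul_conicVec_eq (hc : c ≠ 0) (hd : d ≠ 0) {v w : Fin 2 → K}
    (hw : w ≠ 0) {r : K} (h : r • conicVec a b c d w = conicVec a b c d v) :
    ∃ q : K, q • w = v := by
  have e0 : r * w 0 ^ 2 = v 0 ^ 2 := mul_left_cancel₀ hd <| by
    have := congrFun h 0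
    simp only [conicVec, Pi.smul_apply, smul_eq_mul, Matrix.cons_val] at this
    linear_combination this
  have e1 : r * (w 0 * w 1) = v 0 * v 1 := mul_left_cancel₀ hd <| by
    have := congrFun h 1
    simp only [conicVec, Pi.smul_apply, smul_eq_mul, Matrix.cons_val] at this
    linear_combination this
  have e2 : r * w 1 ^ 2 = v 1 ^ 2 := mul_left_cancel₀ hc <| by
    have := congrFun h 2
    simp only [conicVec, Pi.smul_apply, smul_eq_mul, Matrix.cons_val] at this
    linear_combination this - a * e0 - b * e1
  refine exists_smul_eq_of_mul_eq_mul hw (sub_eq_zero.1 (pow_eq_zero_iff two_ne_zero |>.1 ?_))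
  linear_combination -w 1 ^ 2 * e0 + 2 * w 0 * w 1 * e1 - w 0 ^ 2 * e2

theorem exists_smul_eq_conicVec (hc : c ≠ 0) {P : Fin 3 → K} (hP : P ≠ 0)
    (h : d * P 0 * P 2 = a * P 0 ^ 2 + b * P 0 * P 1 + c * P 1 ^ 2) :
    ∃ v : Fin 2 → K, v ≠ 0 ∧ ∃ r : K, r • P = conicVec a b c d v := by
  by_cases h0 : P 0 = 0
  · have h1 : P 1 = 0 := by simpa [h0, hc] using h
    have h2 : P 2 ≠ 0 := fun h2 => hP (by ext i; fin_cases i <;> simp [h0, h1, h2])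
    refine ⟨![0, 1], fun hv => one_ne_zero (congrFun hv 1), c / P 2, ?_⟩
    ext i
    fin_cases i <;> simp [conicVec, h0, h1, h2]
  · refine ⟨![P 0, P 1], fun hv => h0 (congrFun hv 0), d * P 0, ?_⟩
    ext i
    fin_cases i
    · simp [conicVec]; ring
    · simp [conicVec]
    · simpa [conicVec] using h

/-- The parametrization of the conic `d x z = a x² + b x y + c y²` by the projective line. -/
def conicMap (a b : K) (hc : c ≠ 0) (hd : d ≠ 0) : ℙ K (Fin 2 → K) → ℙ K (Fin 3 → K) :=
  Projectivization.lift
    (fun v => Projectivization.mk K (conicVec a b c d v) (conicVec_ne_zero hc hd v.2))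
    fun v w r h => (Projectivization.mk_eq_mk_iff' ..).2 ⟨r ^ 2, by rw [h, conicVec_smul]⟩

theorem conicMap_mk (hc : c ≠ 0) (hd : d ≠ 0) {v : Fin 2 → K} (hv : v ≠ 0) :
    conicMap a b hc hd (Projectivization.mk K v hv) =
      Projectivization.mk K (conicVec a b c d v) (conicVec_ne_zero hc hd hv) :=
  rfl

theorem conicMap_injective (hc : c ≠ 0) (hd : d ≠ 0) :
    Function.Injective (conicMap a b hc hd) := by
  intro x y h
  induction x using Projectivization.ind with | h v hv =>
  induction y using Projectivization.ind with | h w hw =>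
  rw [conicMap_mk, conicMap_mk, Projectivization.mk_eq_mk_iff'] at h
  obtain ⟨r, hr⟩ := h
  exact (Projectivization.mk_eq_mk_iff' ..).2 (exists_smul_eq_of_smul_conicVec_eq hc hd hw hr)

theorem range_conicMap (hc : c ≠ 0) (hd : d ≠ 0) :
    Set.range (conicMap a b hc hd) = {x : ℙ K (Fin 3 → K) |
      d * x.rep 0 * x.rep 2 = a * x.rep 0 ^ 2 + b * x.rep 0 * x.rep 1 + c * x.rep 1 ^ 2} := by
  ext x
  constructor
  · rintro ⟨y, rfl⟩
    induction y using Projectivization.ind with | h v hv =>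
    obtain ⟨r, hr⟩ := Projectivization.exists_smul_eq_mk_rep K _
      (conicVec_ne_zero (a := a) (b := b) hc hd hv)
    rw [Set.mem_ofPred_eq, conicMap_mk, ← hr]
    simp only [conicVec, Pi.smul_apply, Units.smul_def, smul_eq_mul, Matrix.cons_val]
    ring
  · intro hx
    obtain ⟨v, hv, hr⟩ := exists_smul_eq_conicVec hc x.rep_nonzero hx
    refine ⟨Projectivization.mk K v hv, ?_⟩
    rw [conicMap_mk, ← x.mk_rep]
    exact (Projectivization.mk_eq_mk_iff' ..).2 (by simpa using hr)

end ConicVec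

/-- the map `[S : T] ↦ [D S² : D S T : A S² + B S T + C T²]` is a
well-defined bijection from `ℙ¹(ℚ)` onto the rational points of the conic
`Φ_{A,B,C,D} = 0` in `ℙ²(ℚ)`. -/
theorem stmt10 (A B C D : ℤ) (hC : 1 ≤ C) (hD : 1 ≤ D) :
    ∃ ρ : ℙ ℚ (Fin 2 → ℚ) → ℙ ℚ (Fin 3 → ℚ),
      (∀ (v : Fin 2 → ℚ) (hv : v ≠ 0),
        ∃ hw : (![(D : ℚ) * v 0 ^ 2, (D : ℚ) * v 0 * v 1,
            (A : ℚ) * v 0 ^ 2 + (B : ℚ) * v 0 * v 1 + (C : ℚ) * v 1 ^ 2] : Fin 3 → ℚ) ≠ 0,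
          ρ (Projectivization.mk ℚ v hv) =
            Projectivization.mk ℚ
              ![(D : ℚ) * v 0 ^ 2, (D : ℚ) * v 0 * v 1,
                (A : ℚ) * v 0 ^ 2 + (B : ℚ) * v 0 * v 1 + (C : ℚ) * v 1 ^ 2] hw) ∧
      Function.Injective ρ ∧
      Set.range ρ = {x : ℙ ℚ (Fin 3 → ℚ) | PhiQ A B C D x.rep = 0} := by
  have hc : (C : ℚ) ≠ 0 := Int.cast_ne_zero.2 (by omega)
  have hd : (D : ℚ) ≠ 0 := Int.cast_ne_zero.2 (by omega)
  refine ⟨conicMap (A : ℚ) (B : ℚ) hc hd,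
    fun v hv => ⟨conicVec_ne_zero hc hd hv, conicMap_mk hc hd hv⟩, conicMap_injective hc hd, ?_⟩
  rw [range_conicMap]
  ext x
  simp only [Set.mem_ofPred_eq, PhiQ]
  constructor <;> intro h <;> linear_combination h

end
end

section
/- Let A, B, C, D be integers with C ≥ 1 and D ≥ 1, let R = R_{A,B,C,D} ⊆ Mat₂(ℤ), and let s, t be coprime integers. Let L ⊆ ℤ² be the ℤ-span of the set {M·(s,t) : M ∈ R}. Then L has finite index in ℤ² equal to gcd(D·s², D·s·t, A·s² + B·s·t + C·t²). -/
noncomputable section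

/-- The linear form `v ↦ s v₁ - t v₀`, whose kernel is spanned by `(s, t)` when `s, t` are
coprime. -/
def wedgeForm (s t : ℤ) : (Fin 2 → ℤ) →ₗ[ℤ] ℤ :=
  s • LinearMap.proj 1 - t • LinearMap.proj 0

lemma wedgeForm_apply (s t : ℤ) (v : Fin 2 → ℤ) : wedgeForm s t v = s * v 1 - t * v 0 := by
  simp [wedgeForm]

lemma wedgeForm_surjective {s t : ℤ} (hst : IsCoprime s t) :
    Function.Surjective (wedgeForm s t) := by
  obtain ⟨u, w, h⟩ := hst
  intro k
  refine ⟨![-(w * k), u * k], ?_⟩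
  simp only [wedgeForm_apply, Matrix.cons_val_zero, Matrix.cons_val_one]
  linear_combination k * h

lemma eq_smul_of_wedgeForm_eq_zero {s t : ℤ} (hst : IsCoprime s t) {v : Fin 2 → ℤ}
    (hv : wedgeForm s t v = 0) : ∃ n : ℤ, v = n • ![s, t] := by
  obtain ⟨u, w, h⟩ := hst
  rw [wedgeForm_apply] at hv
  refine ⟨u * v 0 + w * v 1, ?_⟩
  ext i
  fin_cases i
  · simp
    linear_combination -(v 0) * h - w * hv
  · simp
    linear_combination -(v 1) * h + u * hv

/-- The `ℤ`-span of the orbit `R_{A,B,C,D}·(s,t)` is spanned by the images of the generators. -/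
lemma span_Rring_mulVec (A B C D s t : ℤ) :
    Submodule.span ℤ {v : Fin 2 → ℤ | ∃ M ∈ Rring A B C D, v = M.mulVec ![s, t]} =
      Submodule.span ℤ {![s, t], ![B * s + C * t, -(A * s)], ![0, D * t], ![0, D * s]} := by
  have h : {v : Fin 2 → ℤ | ∃ M ∈ Rring A B C D, v = M.mulVec ![s, t]} =
      (Rring A B C D).map ((Matrix.mulVecBilin ℤ ℤ).flip ![s, t]) := by
    ext v
    simp [eq_comm]
  rw [h, Submodule.span_eq, Rring, Submodule.map_span]
  simp [Set.image_insert_eq, Matrix.cons_mulVec, dotProduct, -Matrix.mulVec_cons]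

/-- The lattice `R_{A,B,C,D}·(s,t)` is cut out by a single congruence. -/
lemma span_Rring_mulVec_eq_comap (A B C D : ℤ) {s t : ℤ} (hst : IsCoprime s t) :
    (Submodule.span ℤ
        {v : Fin 2 → ℤ | ∃ M ∈ Rring A B C D, v = M.mulVec ![s, t]}).toAddSubgroup =
      (AddSubgroup.zmultiples ((Int.gcd (Int.gcd (D * s ^ 2) (D * s * t))
        (A * s ^ 2 + B * s * t + C * t ^ 2) : ℕ) : ℤ)).comap
          (wedgeForm s t).toAddMonoidHom := by
  rw [span_Rring_mulVec]
  set Q := A * s ^ 2 + B * s * t + C * t ^ 2 with hQ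
  set e := Int.gcd (D * s ^ 2) (D * s * t) with he
  set g := Int.gcd e Q with hg
  have hgQ : (g : ℤ) ∣ Q := Int.gcd_dvd_right ..
  have hge : (g : ℤ) ∣ e := Int.gcd_dvd_left ..
  have hgs : (g : ℤ) ∣ D * s ^ 2 := hge.trans (Int.gcd_dvd_left ..)
  have hgt : (g : ℤ) ∣ D * s * t := hge.trans (Int.gcd_dvd_right ..)
  ext v
  simp only [Submodule.mem_toAddSubgroup, AddSubgroup.mem_comap, LinearMap.toAddMonoidHom_coe,
    Int.mem_zmultiples_iff]
  constructor
  · intro hv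
    induction hv using Submodule.span_induction with
    | mem x hx =>
      simp only [Set.mem_insert_iff, Set.mem_singleton_iff] at hx
      rcases hx with rfl | rfl | rfl | rfl <;>
        simp only [wedgeForm_apply, Matrix.cons_val_zero, Matrix.cons_val_one]
      · exact ⟨0, by ring⟩
      · exact (hgQ.neg_right).trans (dvd_of_eq (by rw [hQ]; ring))
      · exact hgt.trans (dvd_of_eq (by ring))
      · exact hgs.trans (dvd_of_eq (by ring))
    | zero => simp
    | add x y _ _ hx hy => rw [map_add]; exact dvd_add hx hy
    | smul a x _ hx => rw [map_smul]; exact hx.mul_left a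
  · rintro ⟨k, hk⟩
    have h1 : (g : ℤ) = _ := Int.gcd_eq_gcd_ab e Q
    have h2 : (e : ℤ) = _ := Int.gcd_eq_gcd_ab (D * s ^ 2) (D * s * t)
    generalize Int.gcdA e Q = a at h1
    generalize Int.gcdB e Q = b at h1
    generalize Int.gcdA (D * s ^ 2) (D * s * t) = c at h2
    generalize Int.gcdB (D * s ^ 2) (D * s * t) = d at h2
    let w : Fin 2 → ℤ := (-(b * k)) • ![B * s + C * t, -(A * s)] +
      ((a * d * k) • ![0, D * t] + (a * c * k) • ![0, D * s])
    have hw : wedgeForm s t (v - w) = 0 := by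
      rw [map_sub, hk, wedgeForm_apply]
      simp [w]
      linear_combination k * h1 + k * a * h2 + k * b * hQ
    obtain ⟨n, hn⟩ := eq_smul_of_wedgeForm_eq_zero hst hw
    rw [sub_eq_iff_eq_add.mp hn]
    refine add_mem ?_ (add_mem ?_ (add_mem ?_ ?_)) <;>
      exact Submodule.smul_mem _ _ (Submodule.subset_span (by simp))

/-- for `s, t` coprime, the lattice `R_{A,B,C,D}·(s,t) ⊆ ℤ²` has index
`gcd(D s², D s t, A s² + B s t + C t²)`. -/
theorem stmt11 (A B C D : ℤ) (hC : 1 ≤ C) (hD : 1 ≤ D) (s t : ℤ) (hst : IsCoprime s t) :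
    ((Submodule.span ℤ
        {v : Fin 2 → ℤ | ∃ M ∈ Rring A B C D, v = M.mulVec ![s, t]}).toAddSubgroup).index =
      Int.gcd (Int.gcd (D * s ^ 2) (D * s * t)) (A * s ^ 2 + B * s * t + C * t ^ 2) := by
  rw [span_Rring_mulVec_eq_comap A B C D hst,
    AddSubgroup.index_comap_of_surjective _ (wedgeForm_surjective hst), Int.index_zmultiples,
    Int.natAbs_natCast]

end
end

section
/- Let n be a positive integer and let R = {[[a,b],[c,d]] ∈ Mat₂(ℤ) : n divides b}. Let Λ ⊆ ℤ² be a full-rank ℤ-submodule that is primitive, i.e., Λ is not contained in p·ℤ² for any prime p. Then M·Λ ⊆ Λ for all M ∈ R if and only if there is a positive divisor d of n such that Λ = ℤ·(d,0) + ℤ·(0,1). -/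
noncomputable section

/-- Membership in the lattice `ℤ·(d,0) + ℤ·(0,1)` means that `d` divides the first coordinate. -/
theorem mem_span_diag_iff (d : ℤ) (v : Fin 2 → ℤ) :
    v ∈ Submodule.span ℤ {![d, 0], ![0, 1]} ↔ d ∣ v 0 := by
  rw [Submodule.mem_span_pair]
  constructor
  · rintro ⟨a, b, rfl⟩
    simp
  · rintro ⟨c, hc⟩
    refine ⟨c, v 1, ?_⟩
    ext i
    fin_cases i
    · simp [hc, mul_comm]
    · simp

/-- for the `Γ₀(n)`-order `R = {M ∈ Mat₂(ℤ) : n ∣ M₀₁}`, a primitive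
full-rank lattice `Λ ⊆ ℤ²` is `R`-invariant if and only if `Λ = ℤ·(d,0) + ℤ·(0,1)` for some
positive divisor `d` of `n`. -/
theorem stmt12 (n : ℕ) (hn : 0 < n) (Λ : Submodule ℤ (Fin 2 → ℤ))
    (hfull : Λ.toAddSubgroup.index ≠ 0)
    (hprim : ∀ p : ℕ, p.Prime → ∃ v ∈ Λ, ∃ i : Fin 2, ¬ (p : ℤ) ∣ v i) :
    (∀ M : Matrix (Fin 2) (Fin 2) ℤ, (n : ℤ) ∣ M 0 1 → ∀ v ∈ Λ, M.mulVec v ∈ Λ) ↔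
    ∃ d : ℕ, 0 < d ∧ d ∣ n ∧ Λ = Submodule.span ℤ {![(d : ℤ), 0], ![0, 1]} := by
  constructor
  · intro h
    have hE : ∀ a b c : ℤ, ∀ e : ℤ, ∀ v ∈ Λ,
        ![a * v 0 + n * b * v 1, c * v 0 + e * v 1] ∈ Λ := by
      intro a b c e v hv
      have := h !![a, n * b; c, e] (by simp) v hv
      convert this using 1
      ext i
      fin_cases i <;> simp [Matrix.mulVec, dotProduct, Fin.sum_univ_two]
    let A : Ideal ℤ := Λ.comap (LinearMap.single ℤ (fun _ : Fin 2 => ℤ) 0)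
    let B : Ideal ℤ := Λ.comap (LinearMap.single ℤ (fun _ : Fin 2 => ℤ) 1)
    have hA : ∀ x, x ∈ A ↔ ![x, 0] ∈ Λ := by
      intro x
      have : (Pi.single 0 x : Fin 2 → ℤ) = ![x, 0] := by
        ext i
        fin_cases i <;> simp
      simp [A, this]
    have hB : ∀ x, x ∈ B ↔ ![0, x] ∈ Λ := by
      intro x
      have : (Pi.single 1 x : Fin 2 → ℤ) = ![0, x] := by
        ext i
        fin_cases i <;> simp
      simp [B, this]
    have hv0A : ∀ v ∈ Λ, v 0 ∈ A := fun v hv => by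
      simpa [hA] using hE 1 0 0 0 v hv
    have hv0B : ∀ v ∈ Λ, v 0 ∈ B := fun v hv => by
      simpa [hB] using hE 0 0 1 0 v hv
    have hv1B : ∀ v ∈ Λ, v 1 ∈ B := fun v hv => by
      simpa [hB] using hE 0 0 0 1 v hv
    have hBtop : B = ⊤ := by
      obtain ⟨b, hb⟩ := (IsPrincipalIdealRing.principal B).principal
      have hdvd : ∀ x ∈ B, b ∣ x := fun x hx => by
        rw [hb] at hx
        exact Ideal.mem_span_singleton.mp hx
      by_contra hne
      have hb1 : b.natAbs ≠ 1 := fun h1 => hne <| by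
        rw [hb]
        exact Ideal.span_singleton_eq_top.mpr (Int.isUnit_iff_natAbs_eq.mpr h1)
      obtain ⟨p, hp, hpb⟩ := Nat.exists_prime_and_dvd hb1
      obtain ⟨v, hv, i, hi⟩ := hprim p hp
      have hpb' : (p : ℤ) ∣ b := Int.natCast_dvd.mpr hpb
      fin_cases i
      · exact hi (hpb'.trans (hdvd _ (hv0B v hv)))
      · exact hi (hpb'.trans (hdvd _ (hv1B v hv)))
    have he : ∀ y : ℤ, ![0, y] ∈ Λ := fun y => (hB y).mp (hBtop ▸ Submodule.mem_top)
    obtain ⟨a, ha⟩ := (IsPrincipalIdealRing.principal A).principal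
    have hAdvd : ∀ x, x ∈ A ↔ (a.natAbs : ℤ) ∣ x := fun x => by
      rw [ha, Int.natAbs_dvd]
      exact Ideal.mem_span_singleton
    have hdn : a.natAbs ∣ n := by
      have hnA : (n : ℤ) ∈ A := by
        simpa [hA] using hE 0 1 0 0 _ (he 1)
      exact Int.natCast_dvd_natCast.mp ((hAdvd _).mp hnA)
    refine ⟨a.natAbs, Nat.pos_of_dvd_of_pos hdn hn, hdn, ?_⟩
    ext v
    rw [mem_span_diag_iff, ← hAdvd]
    refine ⟨hv0A v, fun hv => ?_⟩
    have hsum := Λ.add_mem ((hA _).mp hv) (he (v 1))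
    convert hsum using 1
    ext i
    fin_cases i <;> simp
  · rintro ⟨d, -, hdn, rfl⟩ M hM v hv
    rw [mem_span_diag_iff] at hv ⊢
    have hdM : (d : ℤ) ∣ M 0 1 := (Int.natCast_dvd_natCast.mpr hdn).trans hM
    simp only [Matrix.mulVec, dotProduct, Fin.sum_univ_two]
    exact dvd_add (hv.mul_left _) (hdM.mul_right _)

end
end

section
/- Let A, B, C, D be integers with C ≥ 1 and D ≥ 1, let Φ = Φ_{A,B,C,D} and R = R_{A,B,C,D}. Let ξ ∈ ℝ be irrational and set Ξ = (D·ξ², D·ξ, A·ξ² + B·ξ + C) ∈ ℝ³, so Φ(Ξ) = 0 and Ξ spans an irrational line. For every primitive R-invariant full-rank lattice Λ ⊆ ℤ² and every ℤ-basis (u,w) of Λ, write (ξ,1) = S·u + T·w with S, T ∈ ℝ (then T ≠ 0), and set ξ_{Λ,u,w} = S/T (an irrational real). Then for every Σ ∈ ℝ³ with ⟨Σ,Ξ⟩_Φ = 0 and Σ not a real scalar multiple of Ξ: λ_Φ(Ξ;Σ) equals the supremum, over all primitive R-invariant full-rank lattices Λ ⊆ ℤ² and all ℤ-bases (u,w)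 of Λ, of λ(ξ_{Λ,u,w}), where λ(η) = limsup_{q ∈ ℚ, q → η} 1/(den(q)²·|q − η|). -/
noncomputable section
open Filter Topology
open scoped ENNReal LinearAlgebra.Projectivization

/-- `Λ` is invariant under the ring `R_{A,B,C,D}`. -/
def RInvariant (A B C D : ℤ) (Λ : Submodule ℤ (Fin 2 → ℤ)) : Prop :=
  ∀ M ∈ Rring A B C D, ∀ v ∈ Λ, M.mulVec v ∈ Λ

/-- `Λ ⊆ ℤ²` is primitive: not contained in `p·ℤ²` for any prime `p`. -/
def PrimLat (Λ : Submodule ℤ (Fin 2 → ℤ)) : Prop :=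
  ∀ p : ℕ, p.Prime → ∃ v ∈ Λ, ∃ i : Fin 2, ¬ (p : ℤ) ∣ v i

def castVec2 (u : Fin 2 → ℤ) : Fin 2 → ℝ := fun i => (u i : ℝ)

theorem limsup_le_of_ratio {α β : Type*} {F : Filter α} {G : Filter β} {f : α → ℝ≥0∞}
    {h : β → ℝ≥0∞} {φ : α → β} {r : α → ℝ} (hr : Tendsto r F (𝓝 1)) (hφ : Tendsto φ F G)
    (hle : ∀ᶠ a in F, f a ≤ ENNReal.ofReal (r a) * h (φ a)) : limsup f F ≤ limsup h G := by
  refine le_of_forall_gt fun c hc => ?_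
  obtain ⟨c', hc', hcc⟩ := exists_between hc
  have htop : c' ≠ ∞ := hcc.ne_top
  have hlim : Tendsto (fun a => ENNReal.ofReal (r a) * c') F (𝓝 c') := by
    have := ENNReal.Tendsto.mul_const (ENNReal.tendsto_ofReal hr) (Or.inr htop)
    simpa using this
  obtain ⟨c'', h1, h2⟩ := exists_between hcc
  have hev : ∀ᶠ a in F, f a ≤ c'' := by
    filter_upwards [hle, hφ.eventually (eventually_lt_of_limsup_lt hc'),
      hlim.eventually (gt_mem_nhds h1)] with a ha hb hd
    exact ha.trans ((mul_le_mul_right hb.le _).trans hd.le)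
  exact (limsup_le_of_le (h := hev)).trans_lt h2

theorem limsup_le_of_finite_cover {α κ : Type*} {F : Filter α} {f : α → ℝ≥0∞} (K : α → κ)
    (hfin : (Set.range K).Finite) {c : ℝ≥0∞}
    (h : ∀ a₀, limsup f (F ⊓ 𝓟 {a | K a = K a₀}) ≤ c) : limsup f F ≤ c := by
  refine le_of_forall_gt_imp_ge_of_dense fun c' hc' => limsup_le_of_le (h := ?_)
  have hev : ∀ k ∈ Set.range K, ∀ᶠ a in F, K a = k → f a < c' := by
    rintro _ ⟨a₀, rfl⟩
    exact eventually_inf_principal.1 (eventually_lt_of_limsup_lt ((h a₀).trans_lt hc'))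
  filter_upwards [(hfin.eventually_all).2 hev] with a ha
  exact (ha (K a) ⟨a, rfl⟩ rfl).le

/-- The real neighborhoods of `ξ`, traced on the rationals. -/
abbrev ratNhds (ξ : ℝ) : Filter ℚ := comap (fun q : ℚ => (q : ℝ)) (𝓝 ξ)

theorem tendsto_ratNhds_comp {X : Type*} [TopologicalSpace X] {ξ : ℝ} {g : ℝ → X}
    (hg : ContinuousAt g ξ) :
    Tendsto (fun q : ℚ => g q) (ratNhds ξ) (𝓝 (g ξ)) :=
  hg.tendsto.comp tendsto_comap

theorem Rat.exists_eq_mul_num_den (a : ℤ) {b : ℤ} (hb : b ≠ 0) :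
    ∃ k : ℤ, k ≠ 0 ∧ a = k * ((a : ℚ) / b).num ∧ b = k * ((a : ℚ) / b).den := by
  obtain ⟨k, h1, h2⟩ := Rat.exists_eq_mul_div_num_and_eq_mul_div_den a hb
  refine ⟨k, ?_, h1, h2⟩
  rintro rfl
  simp at h2
  exact hb h2

theorem exists_rep_mk_eq_mul (v : V3) (hv : v ≠ 0) :
    ∃ a : ℝ, a ≠ 0 ∧ ∀ i, (Projectivization.mk ℝ v hv).rep i = a * v i := by
  obtain ⟨a, ha⟩ := Projectivization.exists_smul_eq_mk_rep ℝ v hv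
  exact ⟨a, a.ne_zero, fun i => by rw [← ha]; rfl⟩

theorem rep_ratio_mk (v : V3) (hv : v ≠ 0) : (Projectivization.mk ℝ v hv).rep 0 /
    (Projectivization.mk ℝ v hv).rep 1 = v 0 / v 1 := by
  obtain ⟨a, ha, h⟩ := exists_rep_mk_eq_mul v hv
  rw [h, h, mul_div_mul_left _ _ ha]

theorem continuousAt_rep_ratio {Ξ : V3} (hΞ : Ξ ≠ 0) (h1 : Ξ 1 ≠ 0) :
    ContinuousAt (fun x : ℙ ℝ V3 => x.rep 0 / x.rep 1) (Projectivization.mk ℝ Ξ hΞ) := by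
  rw [ContinuousAt, tendsto_nhds]
  intro V hV hmem
  let W : Set (ℙ ℝ V3) := {x | x.rep 1 ≠ 0 ∧ x.rep 0 / x.rep 1 ∈ V}
  have hW : IsOpen W := by
    rw [isOpen_coinduced]
    have hpre : Projectivization.mk' ℝ ⁻¹' W =
        {v : {v : V3 // v ≠ 0} | v.1 1 ≠ 0} ∩ (fun v => v.1 0 / v.1 1) ⁻¹' V := by
      ext ⟨v, hv⟩
      obtain ⟨a, ha, h⟩ := exists_rep_mk_eq_mul v hv
      simp [W, Projectivization.mk'_eq_mk, h, ha, mul_div_mul_left]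
    have hc : ∀ i, Continuous fun v : {v : V3 // v ≠ 0} => v.1 i := fun i =>
      (continuous_apply i).comp continuous_subtype_val
    rw [hpre]
    exact ContinuousOn.isOpen_inter_preimage
      (fun v hv => ((hc 0).continuousAt.div (hc 1).continuousAt hv).continuousWithinAt)
      (isOpen_ne_fun (hc 1) continuous_const) hV
  have hΞW : Projectivization.mk ℝ Ξ hΞ ∈ W := by
    obtain ⟨a, ha, h⟩ := exists_rep_mk_eq_mul Ξ hΞ
    exact ⟨by rw [h]; exact mul_ne_zero ha h1, hmem⟩
  exact mem_of_superset (hW.mem_nhds hΞW) fun x hx => hx.2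

/-- The greatest common divisor of the coordinates of the point of the conic
`Φ_{A,B,C,D} = 0` with homogeneous parameter `(s, t)`. -/
def conicContent (A B C D s t : ℤ) : ℕ :=
  Int.gcd (Int.gcd (D * s ^ 2) (D * s * t)) (A * s ^ 2 + B * s * t + C * t ^ 2)

/-- The approximation quality of `q` to `ξ`, weighted by the content of the associated point
of the conic. -/
def weightedQuality (A B C D : ℤ) (ξ : ℝ) (q : ℚ) : ℝ≥0∞ :=
  ENNReal.ofReal (conicContent A B C D q.num q.den / ((q.den : ℝ) ^ 2 * |(q : ℝ) - ξ|))

section Content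

variable {A B C D s t : ℤ}

theorem conicContent_dvd₀ : (conicContent A B C D s t : ℤ) ∣ D * s ^ 2 :=
  (Int.gcd_dvd_left _ _).trans (Int.gcd_dvd_left _ _)

theorem conicContent_dvd₁ : (conicContent A B C D s t : ℤ) ∣ D * s * t :=
  (Int.gcd_dvd_left _ _).trans (Int.gcd_dvd_right _ _)

theorem conicContent_dvd₂ :
    (conicContent A B C D s t : ℤ) ∣ A * s ^ 2 + B * s * t + C * t ^ 2 :=
  Int.gcd_dvd_right _ _

theorem conicContent_bezout : ∃ x y z : ℤ, (conicContent A B C D s t : ℤ) =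
    x * (D * s ^ 2) + y * (D * s * t) + z * (A * s ^ 2 + B * s * t + C * t ^ 2) := by
  have h1 := Int.gcd_eq_gcd_ab (Int.gcd (D * s ^ 2) (D * s * t))
    (A * s ^ 2 + B * s * t + C * t ^ 2)
  have h2 := Int.gcd_eq_gcd_ab (D * s ^ 2) (D * s * t)
  rw [conicContent, h1]
  generalize Int.gcdA (Int.gcd (D * s ^ 2) (D * s * t) : ℤ) _ = x
  generalize Int.gcdB (Int.gcd (D * s ^ 2) (D * s * t) : ℤ) _ = y
  rw [h2]
  exact ⟨x * Int.gcdA (D * s ^ 2) (D * s * t), x * Int.gcdB (D * s ^ 2) (D * s * t), y, by ring⟩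

theorem conicContent_pos (hC : C ≠ 0) (hD : D ≠ 0) (ht : t ≠ 0) :
    0 < conicContent A B C D s t := by
  rw [Nat.pos_iff_ne_zero]
  intro h
  have h0 := conicContent_dvd₀ (A := A) (B := B) (C := C) (D := D) (s := s) (t := t)
  have h2 := conicContent_dvd₂ (A := A) (B := B) (C := C) (D := D) (s := s) (t := t)
  rw [h, Nat.cast_zero, zero_dvd_iff] at h0 h2
  have hs : s = 0 := by simpa [hD] using h0
  simp [hs, hC, ht] at h2

theorem conicContent_dvd_mul (hst : IsCoprime s t) :
    (conicContent A B C D s t : ℤ) ∣ C * D := by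
  obtain ⟨x, y, hxy⟩ := hst.pow (m := 2) (n := 2)
  have h0 := conicContent_dvd₀ (A := A) (B := B) (C := C) (D := D) (s := s) (t := t)
  have h1 := conicContent_dvd₁ (A := A) (B := B) (C := C) (D := D) (s := s) (t := t)
  have h2 := conicContent_dvd₂ (A := A) (B := B) (C := C) (D := D) (s := s) (t := t)
  have : C * D = (x * C - y * A) * (D * s ^ 2) + (-y * B) * (D * s * t) +
      y * D * (A * s ^ 2 + B * s * t + C * t ^ 2) := by linear_combination (-C * D) * hxy
  rw [this]
  exact dvd_add (dvd_add (h0.mul_left _) (h1.mul_left _)) (h2.mul_left _)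

end Content

/-- The lattice spanned by a primitive vector `(s, t)` and `n · ℤ²`, where `x s + y t = 1`. -/
theorem mem_span_iff_dvd_det {n s t x y : ℤ} (hxy : x * s + y * t = 1) (v : Fin 2 → ℤ) :
    v ∈ Submodule.span ℤ {![s, t], ![-(n * y), n * x]} ↔ n ∣ s * v 1 - t * v 0 := by
  rw [Submodule.mem_span_pair]
  constructor
  · rintro ⟨a, k, rfl⟩
    refine ⟨k, ?_⟩
    simp
    linear_combination (k * n) * hxy
  · rintro ⟨k, hk⟩
    refine ⟨x * v 0 + y * v 1, k, ?_⟩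
    ext i
    fin_cases i
    · simp
      linear_combination y * hk + v 0 * hxy
    · simp
      linear_combination (-x) * hk + v 1 * hxy

theorem index_span_ne_zero {n s t x y : ℤ} (hn : n ≠ 0) (hxy : x * s + y * t = 1) :
    (Submodule.span ℤ {![s, t], ![-(n * y), n * x]}).toAddSubgroup.index ≠ 0 := by
  let f : (Fin 2 → ℤ) →+ ℤ :=
    { toFun := fun v => s * v 1 - t * v 0
      map_zero' := by simp
      map_add' := fun v w => by simp; ring }
  have hf : Function.Surjective f := fun k => ⟨![-(k * y), k * x], by
    simp [f]; linear_combination k * hxy⟩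
  have heq : (Submodule.span ℤ {![s, t], ![-(n * y), n * x]}).toAddSubgroup =
      (AddSubgroup.zmultiples n).comap f := by
    ext v
    rw [AddSubgroup.mem_comap, Int.mem_zmultiples_iff]
    exact mem_span_iff_dvd_det hxy v
  rw [heq, AddSubgroup.index_comap_of_surjective _ hf, Int.index_zmultiples]
  exact Int.natAbs_ne_zero.2 hn

theorem primLat_of_mem {Λ : Submodule ℤ (Fin 2 → ℤ)} {s t : ℤ} (hst : IsCoprime s t)
    (h : ![s, t] ∈ Λ) : PrimLat Λ := by
  intro p hp
  by_contra! hcon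
  have h0 := hcon _ h 0
  have h1 := hcon _ h 1
  have := hst.isUnit_of_dvd' h0 h1
  exact (Nat.prime_iff_prime_int.1 hp).not_isUnit this

theorem rInvariant_iff {A B C D : ℤ} {Λ : Submodule ℤ (Fin 2 → ℤ)} :
    RInvariant A B C D Λ ↔ ∀ v ∈ Λ, ![B * v 0 + C * v 1, -A * v 0] ∈ Λ ∧
      ![0, D * v 1] ∈ Λ ∧ ![0, D * v 0] ∈ Λ := by
  have e : ∀ (a b c d : ℤ) (v : Fin 2 → ℤ), (!![a, b; c, d]).mulVec v =
      ![a * v 0 + b * v 1, c * v 0 + d * v 1] := fun a b c d v => by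
    ext i; fin_cases i <;> simp [Matrix.mulVec, dotProduct, Fin.sum_univ_two]
  constructor
  · intro h v hv
    have h1 := h _ (Submodule.subset_span (Set.mem_insert_of_mem _ (Set.mem_insert _ _))) v hv
    have h2 := h _ (Submodule.subset_span (Set.mem_insert_of_mem _ (Set.mem_insert_of_mem _
      (Set.mem_insert _ _)))) v hv
    have h3 := h _ (Submodule.subset_span (Set.mem_insert_of_mem _ (Set.mem_insert_of_mem _
      (Set.mem_insert_of_mem _ (Set.mem_singleton _))))) v hv
    rw [e] at h1 h2 h3
    simp only [zero_mul, zero_add, add_zero] at h1 h2 h3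
    exact ⟨h1, h2, h3⟩
  · intro h M hM v hv
    obtain ⟨h1, h2, h3⟩ := h v hv
    induction hM using Submodule.span_induction with
    | mem M hM =>
      rcases hM with rfl | rfl | rfl | rfl
      · simpa using hv
      · rw [e]; simpa using h1
      · rw [e]; simpa using h2
      · rw [e]; simpa using h3
    | zero => simp
    | add M N _ _ hM hN => rw [Matrix.add_mulVec]; exact Λ.add_mem hM hN
    | smul a M _ hM => rw [Matrix.smul_mulVec]; exact Λ.smul_mem a hM

theorem rInvariant_span {A B C D s t x y : ℤ} (hxy : x * s + y * t = 1) :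
    RInvariant A B C D (Submodule.span ℤ {![s, t],
      ![-((conicContent A B C D s t : ℤ) * y), (conicContent A B C D s t : ℤ) * x]}) := by
  rw [rInvariant_iff]
  intro v hv
  simp only [mem_span_iff_dvd_det hxy]
  obtain ⟨a, k, rfl⟩ := Submodule.mem_span_pair.1 hv
  obtain ⟨c₀, h0⟩ := conicContent_dvd₀ (A := A) (B := B) (C := C) (D := D) (s := s) (t := t)
  obtain ⟨c₁, h1⟩ := conicContent_dvd₁ (A := A) (B := B) (C := C) (D := D) (s := s) (t := t)
  obtain ⟨c₂, h2⟩ := conicContent_dvd₂ (A := A) (B := B) (C := C) (D := D) (s := s) (t := t)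
  generalize (conicContent A B C D s t : ℤ) = n at *
  refine ⟨⟨-a * c₂ + k * (A * s * y + B * t * y - C * t * x), ?_⟩,
    ⟨a * c₁ + k * D * s * x, ?_⟩, ⟨a * c₀ - k * D * s * y, ?_⟩⟩
  · simp; linear_combination (-a) * h2
  · simp; linear_combination a * h1
  · simp; linear_combination a * h0

/-- The determinant of two vectors of a lattice is a multiple of that of a basis. -/
theorem det_dvd_of_mem_span {u w v v' : Fin 2 → ℤ} (hv : v ∈ Submodule.span ℤ {u, w})
    (hv' : v' ∈ Submodule.span ℤ {u, w}) :
    u 0 * w 1 - u 1 * w 0 ∣ v 0 * v' 1 - v 1 * v' 0 := by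
  obtain ⟨a, b, rfl⟩ := Submodule.mem_span_pair.1 hv
  obtain ⟨c, d, rfl⟩ := Submodule.mem_span_pair.1 hv'
  refine ⟨a * d - b * c, ?_⟩
  simp
  ring

theorem det_dvd_sq_mul_conicContent {A B C D k s t : ℤ} {u w : Fin 2 → ℤ}
    (hR : RInvariant A B C D (Submodule.span ℤ {u, w}))
    (hv : ![k * s, k * t] ∈ Submodule.span ℤ {u, w}) :
    u 0 * w 1 - u 1 * w 0 ∣ k ^ 2 * conicContent A B C D s t := by
  obtain ⟨h2, h1, h0⟩ := rInvariant_iff.1 hR _ hv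
  obtain ⟨c₀, h0⟩ := det_dvd_of_mem_span hv h0
  obtain ⟨c₁, h1⟩ := det_dvd_of_mem_span hv h1
  obtain ⟨c₂, h2⟩ := det_dvd_of_mem_span hv h2
  simp at h0 h1 h2
  obtain ⟨x, y, z, h⟩ := conicContent_bezout (A := A) (B := B) (C := C) (D := D) (s := s) (t := t)
  refine ⟨x * c₀ + y * c₁ - z * c₂, ?_⟩
  rw [h]
  linear_combination x * h0 + y * h1 - z * h2

section LatticeTransfer

variable {ξ S T : ℝ} {u w : Fin 2 → ℤ}

theorem coord_eqs (h : S • castVec2 u + T • castVec2 w = ![ξ, 1]) :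
    S * u 0 + T * w 0 = ξ ∧ S * u 1 + T * w 1 = 1 :=
  ⟨by simpa [castVec2] using congrFun h 0, by simpa [castVec2] using congrFun h 1⟩

theorem _root_.Irrational.eq_zero_of_int_mul_eq (hξ : Irrational ξ) {a b : ℤ}
    (h : (a : ℝ) * ξ = b) : a = 0 ∧ b = 0 := by
  have ha : a = 0 := by
    by_contra ha
    exact (hξ.intCast_mul ha).ne_int b h
  subst ha
  exact ⟨rfl, by simpa using h.symm⟩

theorem det_ne_zero_and_coord_ne_zero (hξ : Irrational ξ) (h0 : S * u 0 + T * w 0 = ξ)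
    (h1 : S * u 1 + T * w 1 = 1) : u 0 * w 1 - u 1 * w 0 ≠ 0 ∧ T ≠ 0 := by
  have hT : T ≠ 0 := by
    rintro rfl
    have := hξ.eq_zero_of_int_mul_eq (a := u 1) (b := u 0) (by
      linear_combination (-(u 1 : ℝ)) * h0 + (u 0 : ℝ) * h1)
    simp [this.1] at h1
  refine ⟨fun hδ => ?_, hT⟩
  have hδ' : (u 0 : ℝ) * w 1 - u 1 * w 0 = 0 := by exact_mod_cast hδ
  have hu := hξ.eq_zero_of_int_mul_eq (a := u 1) (b := u 0) (by
    linear_combination (-(u 1 : ℝ)) * h0 + (u 0 : ℝ) * h1 - T * hδ')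
  have hw := hξ.eq_zero_of_int_mul_eq (a := w 1) (b := w 0) (by
    linear_combination (-(w 1 : ℝ)) * h0 + (w 0 : ℝ) * h1 + S * hδ')
  simp [hu.1, hw.1] at h1

theorem quality_identity {u₀ u₁ w₀ w₁ a b k s t : ℝ} (h0 : S * u₀ + T * w₀ = ξ)
    (h1 : S * u₁ + T * w₁ = 1) (hT : T ≠ 0) (hb : b ≠ 0) (ht : t ≠ 0)
    (hs' : a * u₀ + b * w₀ = k * s) (ht' : a * u₁ + b * w₁ = k * t) :
    k ^ 2 * (t ^ 2 * |s / t - ξ|) =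
      |u₀ * w₁ - u₁ * w₀| * (b ^ 2 * |a / b - S / T|) * |T * (a / b * u₁ + w₁)| := by
  rw [← abs_sq k, ← abs_sq t, ← abs_sq b, ← abs_mul, ← abs_mul, ← abs_mul, ← abs_mul, ← abs_mul]
  congr 1
  have e1 : k ^ 2 * (t ^ 2 * (s / t - ξ)) = (k * t) * (k * s - k * t * ξ) := by
    field_simp
  have e2 : (u₀ * w₁ - u₁ * w₀) * (b ^ 2 * (a / b - S / T)) * (T * (a / b * u₁ + w₁)) =
      (u₀ * w₁ - u₁ * w₀) * (a * T - b * S) * (a * u₁ + b * w₁) := by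
    field_simp
  rw [e1, e2, ← hs', ← ht', ← h0]
  linear_combination (-(a * u₁ + b * w₁)) * (a * u₀ + b * w₀) * h1

theorem one_div_le_mul_div {X Y r d κ G : ℝ} (hX : 0 ≤ X) (hY : 0 ≤ Y) (hr : 0 < r)
    (hd : 0 < d) (hκ : 0 < κ) (hG : d ≤ κ * G) (h : κ * Y = d * X * r) :
    1 / X ≤ r * (G / Y) := by
  have hG0 : 0 < G := pos_of_mul_pos_right (hd.trans_le hG) hκ.le
  rcases hX.eq_or_lt with rfl | hX
  · simp only [div_zero]
    positivity
  have hY : 0 < Y := pos_of_mul_pos_right (h ▸ by positivity) hκ.le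
  rw [← mul_div_assoc, div_le_div_iff₀ hX hY, one_mul]
  refine le_of_mul_le_mul_left ?_ hκ
  calc κ * Y = d * (X * r) := by rw [h, mul_assoc]
    _ ≤ κ * G * (X * r) := by gcongr
    _ = κ * (r * G * X) := by ring

theorem tendsto_mobius {a b c d : ℤ} {x : ℝ} (hx : c * x + d ≠ 0) :
    Tendsto (fun q : ℚ => (a * q + b) / (c * q + d)) (ratNhds x)
      (ratNhds ((a * x + b) / (c * x + d))) := by
  rw [tendsto_comap_iff]
  have hc : ContinuousAt (fun y : ℝ => (a * y + b) / (c * y + d)) x :=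
    ContinuousAt.div (by fun_prop) (by fun_prop) hx
  refine (tendsto_ratNhds_comp hc).congr fun q => ?_
  simp

theorem eventually_affine_ne_zero {c d : ℤ} {x : ℝ} (hx : c * x + d ≠ 0) :
    ∀ᶠ q : ℚ in ratNhds x, (c * q + d : ℚ) ≠ 0 := by
  have hc : ContinuousAt (fun y : ℝ => c * y + d) x := by fun_prop
  filter_upwards [(tendsto_ratNhds_comp hc).eventually_ne hx] with q hq h
  exact hq (by exact_mod_cast h)

theorem tendsto_distortion (h1 : S * u 1 + T * w 1 = 1) (hT : T ≠ 0) :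
    Tendsto (fun p : ℚ => |T * (p * u 1 + w 1)|) (ratNhds (S / T)) (𝓝 1) := by
  have hc : ContinuousAt (fun y : ℝ => |T * (y * u 1 + w 1)|) (S / T) := by fun_prop
  have hval : |T * (S / T * u 1 + w 1)| = 1 := by
    rw [mul_add, ← mul_assoc, mul_div_cancel₀ _ hT, h1, abs_one]
  simpa only [hval] using tendsto_ratNhds_comp hc

theorem lambdaCl_le_limsup_weightedQuality {A B C D : ℤ} (hC : C ≠ 0) (hD : D ≠ 0)
    (hξ : Irrational ξ) (hR : RInvariant A B C D (Submodule.span ℤ {u, w}))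
    (h : S • castVec2 u + T • castVec2 w = ![ξ, 1]) :
    lambdaCl (S / T) ≤ limsup (weightedQuality A B C D ξ) (ratNhds ξ) := by
  obtain ⟨h0, h1⟩ := coord_eqs h
  obtain ⟨hδ, hT⟩ := det_ne_zero_and_coord_ne_zero hξ h0 h1
  have hden : (u 1 : ℝ) * (S / T) + w 1 = 1 / T := by
    field_simp
    linear_combination h1
  have hne : (u 1 : ℝ) * (S / T) + w 1 ≠ 0 := by rw [hden]; exact one_div_ne_zero hT
  have hlim := tendsto_mobius (a := u 0) (b := w 0) hne
  have hξ' : ((u 0 : ℝ) * (S / T) + w 0) / ((u 1 : ℝ) * (S / T) + w 1) = ξ := by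
    rw [hden, ← h0]
    field_simp
  rw [hξ'] at hlim
  refine limsup_le_of_ratio (tendsto_distortion h1 hT) hlim ?_
  filter_upwards [eventually_affine_ne_zero hne] with p hp
  have hb : (p.den : ℚ) ≠ 0 := by exact_mod_cast p.den_ne_zero
  have hv1 : p.num * u 1 + p.den * w 1 ≠ 0 := by
    intro h
    apply hp
    have h' : (p.num : ℚ) * u 1 + p.den * w 1 = 0 := by exact_mod_cast h
    rw [← Rat.num_div_den p]
    field_simp
    linear_combination h'
  obtain ⟨k, hk, hks, hkt⟩ := Rat.exists_eq_mul_num_den (p.num * u 0 + p.den * w 0) hv1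
  have hq : (((p.num * u 0 + p.den * w 0 : ℤ) : ℚ) / (p.num * u 1 + p.den * w 1 : ℤ)) =
      (u 0 * p + w 0) / (u 1 * p + w 1) := by
    have hnum : ∀ x y : ℤ, ((p.num * x + p.den * y : ℤ) : ℚ) = p.den * (x * p + y) := fun x y => by
      push_cast
      rw [← Rat.mul_den_eq_num p]
      ring
    rw [hnum, hnum, mul_div_mul_left _ _ hb]
  rw [hq] at hks hkt
  set q : ℚ := (u 0 * p + w 0) / (u 1 * p + w 1)
  have hmem : ![k * q.num, k * (q.den : ℤ)] ∈ Submodule.span ℤ {u, w} := by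
    rw [Submodule.mem_span_pair]
    refine ⟨p.num, p.den, ?_⟩
    ext i
    fin_cases i
    · simpa using hks
    · simpa using hkt
  have hdvd := det_dvd_sq_mul_conicContent hR hmem
  have hG : |((u 0 * w 1 - u 1 * w 0 : ℤ) : ℝ)| ≤
      (k : ℝ) ^ 2 * conicContent A B C D q.num q.den := by
    have hpos : 0 < k ^ 2 * (conicContent A B C D q.num q.den : ℤ) :=
      mul_pos (by positivity) (by exact_mod_cast conicContent_pos hC hD (by simp))
    exact_mod_cast Int.le_of_dvd hpos ((abs_dvd _ _).2 hdvd)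
  have hid := quality_identity (a := p.num) (b := p.den) (k := k) (s := q.num) (t := q.den)
    h0 h1 hT (by exact_mod_cast p.den_ne_zero) (by exact_mod_cast q.den_ne_zero)
    (by exact_mod_cast hks) (by exact_mod_cast hkt)
  rw [← Rat.cast_def, ← Rat.cast_def] at hid
  rw [weightedQuality, ← ENNReal.ofReal_mul (abs_nonneg _)]
  have hr : (p : ℝ) * u 1 + w 1 ≠ 0 := by
    rw [mul_comm]
    exact_mod_cast hp
  push_cast at hG
  exact ENNReal.ofReal_le_ofReal (one_div_le_mul_div (by positivity) (by positivity)
    (abs_pos.2 (mul_ne_zero hT hr)) (abs_pos.2 (by exact_mod_cast hδ)) (by positivity) hG hid)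

theorem limsup_weightedQuality_le_lambdaCl {A B C D : ℤ} (hξ : Irrational ξ)
    (h : S • castVec2 u + T • castVec2 w = ![ξ, 1]) {E : Set ℚ}
    (hE : ∀ q ∈ E, ![q.num, (q.den : ℤ)] ∈ Submodule.span ℤ {u, w} ∧
      (conicContent A B C D q.num q.den : ℤ) = |u 0 * w 1 - u 1 * w 0|) :
    limsup (weightedQuality A B C D ξ) (ratNhds ξ ⊓ 𝓟 E) ≤ lambdaCl (S / T) := by
  obtain ⟨h0, h1⟩ := coord_eqs h
  obtain ⟨hδ, hT⟩ := det_ne_zero_and_coord_ne_zero hξ h0 h1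
  have hδ' : (u 0 : ℝ) * w 1 - u 1 * w 0 ≠ 0 := by exact_mod_cast hδ
  have hden : ((-u 1 : ℤ) : ℝ) * ξ + u 0 = (u 0 * w 1 - u 1 * w 0) * T := by
    push_cast
    linear_combination (u 1 : ℝ) * h0 - (u 0 : ℝ) * h1
  have hnum : (w 1 : ℝ) * ξ + ((-w 0 : ℤ) : ℝ) = (u 0 * w 1 - u 1 * w 0) * S := by
    push_cast
    linear_combination (-(w 1 : ℝ)) * h0 + (w 0 : ℝ) * h1
  have hne : ((-u 1 : ℤ) : ℝ) * ξ + u 0 ≠ 0 := by rw [hden]; exact mul_ne_zero hδ' hT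
  have hlim := tendsto_mobius (a := w 1) (b := -w 0) hne
  rw [hnum, hden, mul_div_mul_left _ _ hδ'] at hlim
  have hlim' := hlim.mono_left (inf_le_left (b := 𝓟 E))
  have hr := ((tendsto_distortion h1 hT).comp hlim').inv₀ one_ne_zero
  rw [inv_one] at hr
  refine limsup_le_of_ratio hr hlim' ?_
  filter_upwards [(eventually_affine_ne_zero hne).filter_mono inf_le_left,
    mem_inf_of_right (mem_principal_self E)] with q hq hqE
  obtain ⟨hmem, hG⟩ := hE q hqE
  obtain ⟨a, b, hab⟩ := Submodule.mem_span_pair.1 hmem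
  have hs : a * u 0 + b * w 0 = q.num := by simpa using congrFun hab 0
  have ht : a * u 1 + b * w 1 = q.den := by simpa using congrFun hab 1
  have hsQ : (a : ℚ) * u 0 + b * w 0 = q.num := by exact_mod_cast hs
  have htQ : (a : ℚ) * u 1 + b * w 1 = q.den := by exact_mod_cast ht
  have hdQ : (q.den : ℚ) ≠ 0 := by exact_mod_cast q.den_ne_zero
  have hδQ : (u 0 : ℚ) * w 1 - u 1 * w 0 ≠ 0 := by exact_mod_cast hδ
  have hqd := Rat.mul_den_eq_num q
  have ebQ : (q.den : ℚ) * ((-u 1 : ℤ) * q + u 0) = (u 0 * w 1 - u 1 * w 0) * b := by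
    push_cast
    linear_combination (-(u 1 : ℚ)) * hqd + (u 1 : ℚ) * hsQ - (u 0 : ℚ) * htQ
  have eaQ : (q.den : ℚ) * (w 1 * q + (-w 0 : ℤ)) = (u 0 * w 1 - u 1 * w 0) * a := by
    push_cast
    linear_combination (w 1 : ℚ) * hqd - (w 1 : ℚ) * hsQ + (w 0 : ℚ) * htQ
  have hb : b ≠ 0 := by
    rintro rfl
    rw [Int.cast_zero, mul_zero] at ebQ
    exact (mul_ne_zero hdQ hq) ebQ
  have hp : (w 1 * q + (-w 0 : ℤ)) / ((-u 1 : ℤ) * q + u 0) = (a : ℚ) / b := by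
    rw [← mul_div_mul_left _ _ hdQ, ebQ, eaQ, mul_div_mul_left _ _ hδQ]
  obtain ⟨k, hk, hka, hkb⟩ := Rat.exists_eq_mul_num_den a hb
  simp only [Function.comp_apply]
  rw [hp]
  set p : ℚ := (a : ℚ) / b
  have hk1 : k * k = 1 := by
    have hcop : IsCoprime q.num (q.den : ℤ) := Rat.isCoprime_num_den q
    have hu : IsUnit k := hcop.isUnit_of_dvd'
      ⟨p.num * u 0 + p.den * w 0, by rw [← hs]; linear_combination u 0 * hka + w 0 * hkb⟩
      ⟨p.num * u 1 + p.den * w 1, by rw [← ht]; linear_combination u 1 * hka + w 1 * hkb⟩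
    exact Int.isUnit_mul_self hu
  have hks : p.num * u 0 + p.den * w 0 = k * q.num := by
    rw [← hs]
    linear_combination (-k * u 0) * hka - k * w 0 * hkb - (p.num * u 0 + p.den * w 0) * hk1
  have hkt : p.num * u 1 + p.den * w 1 = k * q.den := by
    rw [← ht]
    linear_combination (-k * u 1) * hka - k * w 1 * hkb - (p.num * u 1 + p.den * w 1) * hk1
  have hid := quality_identity (a := p.num) (b := p.den) (k := k) (s := q.num) (t := q.den)
    h0 h1 hT (by exact_mod_cast p.den_ne_zero) (by exact_mod_cast q.den_ne_zero)
    (by exact_mod_cast hks) (by exact_mod_cast hkt)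
  have hk2 : (k : ℝ) ^ 2 = 1 := by rw [sq]; exact_mod_cast hk1
  have hGR : (conicContent A B C D q.num q.den : ℝ) = |(u 0 : ℝ) * w 1 - u 1 * w 0| := by
    exact_mod_cast hG
  rw [← Rat.cast_def, ← Rat.cast_def, hk2, one_mul] at hid
  rw [weightedQuality, ← ENNReal.ofReal_mul (by positivity), hid, hGR]
  refine (congrArg ENNReal.ofReal ?_).le
  rw [mul_assoc, div_mul_cancel_left₀ (abs_ne_zero.2 hδ'), mul_inv, one_div, mul_comm]

end LatticeTransfer

section Conic

variable {A B C D : ℤ} {ξ : ℝ} {Sg : V3}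

theorem XiOf_ne_zero (hC : C ≠ 0) (hD : D ≠ 0) (x : ℝ) : XiOf A B C D x ≠ 0 := by
  intro h
  have h0 := congrFun h 0
  have h2 := congrFun h 2
  have hx : x = 0 := by simpa [XiOf, hD] using h0
  simp [XiOf, hx, hC] at h2

theorem bil_Phi6_apply (P Q : V3) : bil (Phi6 (-A) (-B) (-C) D 0 0) P Q =
    -A * P 0 * Q 0 - B * (P 0 * Q 1 + P 1 * Q 0) / 2 - C * P 1 * Q 1 +
      D * (P 0 * Q 2 + P 2 * Q 0) / 2 := by
  simp only [bil, Phi6, Pi.add_apply]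
  push_cast
  ring

/-- On the cone `Φ_{A,B,C,D} = 0`, the tangent functional of `Σ` is a binary quadratic form
vanishing at `ξ`, whose discriminant is `-Δ Φ(Σ)`. -/
theorem exists_tangent_factorization (hC : 1 ≤ C) (hD : 1 ≤ D)
    (hperp : bil (Phi6 (-A) (-B) (-C) D 0 0) Sg (XiOf A B C D ξ) = 0)
    (hnprop : ∀ c : ℝ, Sg ≠ c • XiOf A B C D ξ) :
    ∃ α β : ℝ, α * ξ + β ≠ 0 ∧
      √((C : ℝ) * (D : ℝ) ^ 2 * |Phi6 (-A) (-B) (-C) D 0 0 Sg|) = |α * ξ + β| ∧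
      ∀ (κ s t : ℝ) (P : V3), P 0 = κ * (D * s ^ 2) → P 1 = κ * (D * s * t) →
        P 2 = κ * (A * s ^ 2 + B * s * t + C * t ^ 2) →
        bil (Phi6 (-A) (-B) (-C) D 0 0) Sg P = κ * ((s - ξ * t) * (α * s + β * t)) := by
  have hC' : (0 : ℝ) < C := by exact_mod_cast hC
  have hD' : (0 : ℝ) < D := by exact_mod_cast hD
  rw [bil_Phi6_apply] at hperp
  simp [XiOf] at hperp
  obtain ⟨a, ha⟩ : ∃ a : ℝ, a = D * (D * Sg 2 - A * Sg 0 - B * Sg 1) / 2 := ⟨_, rfl⟩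
  have hroot : a * ξ ^ 2 - C * D * Sg 1 * ξ + C * D * Sg 0 / 2 = 0 := by
    rw [ha]
    linear_combination hperp
  refine ⟨a, a * ξ - C * D * Sg 1, fun hL => ?_, ?_, fun κ s t P h0 h1 h2 => ?_⟩
  · refine hnprop (2 * a / (C * D ^ 2)) ?_
    have e1 : C * D * Sg 1 = 2 * a * ξ := by linear_combination -hL
    have e0 : C * D * Sg 0 = 2 * a * ξ ^ 2 := by linear_combination 2 * hroot + 2 * ξ * e1
    ext i
    fin_cases i <;> simp [XiOf] <;> field_simp
    · linear_combination e0
    · linear_combination e1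
    · linear_combination (A : ℝ) * e0 + B * e1 - 2 * C * ha
  · rw [← abs_of_pos (show (0 : ℝ) < C * D ^ 2 by positivity), ← abs_mul]
    have : (a * ξ + (a * ξ - C * D * Sg 1)) ^ 2 =
        -(C * D ^ 2 * Phi6 (-A) (-B) (-C) D 0 0 Sg) := by
      simp only [Phi6]
      push_cast
      linear_combination 4 * a * hroot - 2 * C * D * Sg 0 * ha
    rw [← abs_neg, ← this, abs_sq, Real.sqrt_sq_eq_abs]
  · rw [bil_Phi6_apply, h0, h1, h2]
    linear_combination κ * t ^ 2 * hroot - κ * s ^ 2 * ha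

theorem abs_binary_form (α β : ℝ) (q : ℚ) :
    |((q.num : ℝ) - ξ * q.den) * (α * q.num + β * q.den)| =
      (q.den : ℝ) ^ 2 * |(q : ℝ) - ξ| * |α * q + β| := by
  have hd : (q.den : ℝ) ≠ 0 := by exact_mod_cast q.den_ne_zero
  rw [← abs_sq (q.den : ℝ), ← abs_mul, ← abs_mul]
  congr 1
  rw [show (q.num : ℝ) = q * q.den by exact_mod_cast (Rat.mul_den_eq_num q).symm]
  ring

theorem tendsto_tangent_ratio {α β : ℝ} (h : α * ξ + β ≠ 0) :
    Tendsto (fun q : ℚ => |α * ξ + β| / |α * q + β|) (ratNhds ξ) (𝓝 1) := by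
  have hc : ContinuousAt (fun y : ℝ => |α * ξ + β| / |α * y + β|) ξ :=
    ContinuousAt.div (by fun_prop) (by fun_prop) (abs_ne_zero.2 h)
  have := tendsto_ratNhds_comp hc
  rwa [div_self (abs_ne_zero.2 h)] at this

theorem exists_scale_of_conic {P : Fin 3 → ℤ} (hD : D ≠ 0)
    (hP : Phi6 (-A) (-B) (-C) D 0 0 (intCast3 P) = 0) (h0 : P 0 ≠ 0) (h1 : P 1 ≠ 0) {q : ℚ}
    (hq : q = P 0 / P 1) : ∃ κ : ℝ, 1 ≤ |κ| * conicContent A B C D q.num q.den ∧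
      (P 0 : ℝ) = κ * (D * (q.num : ℝ) ^ 2) ∧ (P 1 : ℝ) = κ * (D * q.num * q.den) ∧
      (P 2 : ℝ) = κ * (A * (q.num : ℝ) ^ 2 + B * q.num * q.den + C * (q.den : ℝ) ^ 2) := by
  obtain ⟨k, hk, hk0, hk1⟩ := Rat.exists_eq_mul_num_den (P 0) h1
  rw [← hq] at hk0 hk1
  have hs : q.num ≠ 0 := by
    rintro h
    rw [h, mul_zero] at hk0
    exact h0 hk0
  have hs' : (q.num : ℝ) ≠ 0 := by exact_mod_cast hs
  have hk' : (k : ℝ) ≠ 0 := by exact_mod_cast hk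
  have hD' : (D : ℝ) ≠ 0 := by exact_mod_cast hD
  have hk0' : (P 0 : ℝ) = k * q.num := by exact_mod_cast hk0
  have hk1' : (P 1 : ℝ) = k * q.den := by exact_mod_cast hk1
  have e0 : (P 0 : ℝ) = k / (D * q.num) * (D * (q.num : ℝ) ^ 2) := by
    rw [hk0']
    field_simp
  have e1 : (P 1 : ℝ) = k / (D * q.num) * (D * q.num * q.den) := by
    rw [hk1']
    field_simp
  have e2 : (P 2 : ℝ) = k / (D * q.num) *
      (A * (q.num : ℝ) ^ 2 + B * q.num * q.den + C * (q.den : ℝ) ^ 2) := by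
    simp only [Phi6, intCast3, hk0', hk1'] at hP
    push_cast at hP
    field_simp
    refine mul_left_cancel₀ hk' ?_
    linear_combination hP
  refine ⟨_, ?_, e0, e1, e2⟩
  obtain ⟨x, y, z, h⟩ := conicContent_bezout (A := A) (B := B) (C := C) (D := D)
    (s := q.num) (t := q.den)
  have hR : (conicContent A B C D q.num q.den : ℝ) = x * (D * (q.num : ℝ) ^ 2) +
      y * (D * q.num * q.den) +
      z * (A * (q.num : ℝ) ^ 2 + B * q.num * q.den + C * (q.den : ℝ) ^ 2) := by exact_mod_cast h
  have hint : k / (D * q.num) * (conicContent A B C D q.num q.den : ℝ) =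
      ((x * P 0 + y * P 1 + z * P 2 : ℤ) : ℝ) := by
    push_cast
    rw [hR, e0, e1, e2]
    ring
  have hC0 : (conicContent A B C D q.num q.den : ℝ) ≠ 0 := by
    intro h
    have hz := Nat.cast_eq_zero.1 h
    have := conicContent_dvd₀ (A := A) (B := B) (C := C) (D := D) (s := q.num) (t := q.den)
    rw [hz, Nat.cast_zero, zero_dvd_iff] at this
    exact mul_ne_zero hD (pow_ne_zero 2 hs) this
  rw [← Nat.abs_cast (conicContent A B C D q.num q.den), ← abs_mul, hint]
  have hne : x * P 0 + y * P 1 + z * P 2 ≠ 0 := by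
    intro h
    rw [h, Int.cast_zero] at hint
    exact mul_ne_zero (div_ne_zero hk' (mul_ne_zero hD' hs')) hC0 hint
  exact_mod_cast Int.one_le_abs hne

theorem lambdaPhi_le_limsup_weightedQuality (hC : 1 ≤ C) (hD : 1 ≤ D) (hξ : Irrational ξ)
    (hperp : bil (Phi6 (-A) (-B) (-C) D 0 0) Sg (XiOf A B C D ξ) = 0)
    (hnprop : ∀ c : ℝ, Sg ≠ c • XiOf A B C D ξ) :
    lambdaPhi (Phi6 (-A) (-B) (-C) D 0 0) ((C : ℝ) * (D : ℝ) ^ 2) (XiOf A B C D ξ) Sg ≤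
      limsup (weightedQuality A B C D ξ) (ratNhds ξ) := by
  have hC0 : C ≠ 0 := by lia
  have hD0 : D ≠ 0 := by lia
  have hD' : (D : ℝ) ≠ 0 := by exact_mod_cast hD0
  have hξ0 : ξ ≠ 0 := hξ.ne_zero
  have hΞ := XiOf_ne_zero (A := A) (B := B) hC0 hD0 ξ
  obtain ⟨α, β, hL, hsqrt, hbil⟩ := exists_tangent_factorization hC hD hperp hnprop
  rw [lambdaPhi, dif_pos hΞ]
  set F := comap (fun P : ConicPts (Phi6 (-A) (-B) (-C) D 0 0) =>
    Projectivization.mk ℝ (intCast3 P.1) P.2.1) (𝓝 (Projectivization.mk ℝ _ hΞ))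
  have hratio : XiOf A B C D ξ 0 / XiOf A B C D ξ 1 = ξ := by
    simp [XiOf]
    field_simp
  have hreal : Tendsto (fun P : ConicPts (Phi6 (-A) (-B) (-C) D 0 0) =>
      (((P.1 0 : ℚ) / P.1 1 : ℚ) : ℝ)) F (𝓝 ξ) := by
    have := (continuousAt_rep_ratio hΞ (by simp [XiOf, hD0, hξ0])).tendsto.comp
      (tendsto_comap (f := fun P : ConicPts (Phi6 (-A) (-B) (-C) D 0 0) =>
        Projectivization.mk ℝ (intCast3 P.1) P.2.1))
    rw [rep_ratio_mk, hratio] at this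
    refine this.congr fun P => ?_
    rw [Function.comp_apply, rep_ratio_mk]
    simp [intCast3]
  have hlim : Tendsto (fun P : ConicPts (Phi6 (-A) (-B) (-C) D 0 0) =>
      ((P.1 0 : ℚ) / P.1 1 : ℚ)) F (ratNhds ξ) := tendsto_comap_iff.2 hreal
  refine limsup_le_of_ratio ((tendsto_tangent_ratio hL).comp hlim) hlim ?_
  filter_upwards [hreal.eventually_ne hξ0] with P hP
  have h0 : P.1 0 ≠ 0 := fun h => hP (by simp [h])
  have h1 : P.1 1 ≠ 0 := fun h => hP (by simp [h])
  obtain ⟨κ, hκ, e0, e1, e2⟩ := exists_scale_of_conic hD0 P.2.2 h0 h1 rfl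
  simp only [Function.comp_apply]
  set q : ℚ := (P.1 0 : ℚ) / P.1 1
  rw [hbil κ q.num q.den (intCast3 P.1) e0 e1 e2, hsqrt, abs_mul, abs_binary_form,
    weightedQuality, ← ENNReal.ofReal_mul (by positivity)]
  refine ENNReal.ofReal_le_ofReal ?_
  have hκ0 : 0 < |κ| := pos_of_mul_pos_left (zero_lt_one.trans_le hκ) (Nat.cast_nonneg _)
  have e : |α * ξ + β| / |α * q + β| *
      (conicContent A B C D q.num q.den / ((q.den : ℝ) ^ 2 * |(q : ℝ) - ξ|)) =
      |α * ξ + β| / (|κ| * ((q.den : ℝ) ^ 2 * |(q : ℝ) - ξ| * |α * q + β|)) *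
        (|κ| * conicContent A B C D q.num q.den) := by
    field_simp
  rw [e]
  exact le_mul_of_one_le_right (by positivity) hκ

theorem limsup_weightedQuality_le_lambdaPhi (hC : 1 ≤ C) (hD : 1 ≤ D)
    (hperp : bil (Phi6 (-A) (-B) (-C) D 0 0) Sg (XiOf A B C D ξ) = 0)
    (hnprop : ∀ c : ℝ, Sg ≠ c • XiOf A B C D ξ) :
    limsup (weightedQuality A B C D ξ) (ratNhds ξ) ≤
      lambdaPhi (Phi6 (-A) (-B) (-C) D 0 0) ((C : ℝ) * (D : ℝ) ^ 2) (XiOf A B C D ξ) Sg := by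
  have hC0 : C ≠ 0 := by lia
  have hD0 : D ≠ 0 := by lia
  have hΞ := XiOf_ne_zero (A := A) (B := B) hC0 hD0
  obtain ⟨α, β, hL, hsqrt, hbil⟩ := exists_tangent_factorization hC hD hperp hnprop
  have hpt : ∀ q : ℚ, ∃ P : Fin 3 → ℤ,
      intCast3 P = ((q.den : ℝ) ^ 2 / conicContent A B C D q.num q.den) • XiOf A B C D q := by
    intro q
    have hg : (conicContent A B C D q.num q.den : ℝ) ≠ 0 := by
      exact_mod_cast (conicContent_pos hC0 hD0 (by simp)).ne'
    obtain ⟨c₀, h0⟩ := conicContent_dvd₀ (A := A) (B := B) (C := C) (D := D) (s := q.num)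
      (t := q.den)
    obtain ⟨c₁, h1⟩ := conicContent_dvd₁ (A := A) (B := B) (C := C) (D := D) (s := q.num)
      (t := q.den)
    obtain ⟨c₂, h2⟩ := conicContent_dvd₂ (A := A) (B := B) (C := C) (D := D) (s := q.num)
      (t := q.den)
    refine ⟨![c₀, c₁, c₂], ?_⟩
    generalize conicContent A B C D q.num q.den = g at *
    have hq : (q.num : ℝ) = q * q.den := by exact_mod_cast (Rat.mul_den_eq_num q).symm
    have h0' : (D : ℝ) * (q.num : ℝ) ^ 2 = g * c₀ := by exact_mod_cast h0
    have h1' : (D : ℝ) * q.num * q.den = g * c₁ := by exact_mod_cast h1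
    have h2' : (A : ℝ) * (q.num : ℝ) ^ 2 + B * q.num * q.den + C * (q.den : ℝ) ^ 2 = g * c₂ := by
      exact_mod_cast h2
    rw [hq] at h0' h1' h2'
    ext i
    fin_cases i <;> simp [XiOf, intCast3] <;> field_simp
    · linear_combination -h0'
    · linear_combination -h1'
    · linear_combination -h2'
  choose P hP using hpt
  have hg : ∀ q : ℚ, (conicContent A B C D q.num q.den : ℝ) ≠ 0 := fun q => by
    exact_mod_cast (conicContent_pos hC0 hD0 (by simp)).ne'
  have hd : ∀ q : ℚ, (q.den : ℝ) ≠ 0 := fun q => by exact_mod_cast q.den_ne_zero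
  have hsc : ∀ q : ℚ, (q.den : ℝ) ^ 2 / conicContent A B C D q.num q.den ≠ 0 := fun q =>
    div_ne_zero (pow_ne_zero 2 (hd q)) (hg q)
  have hPne : ∀ q, intCast3 (P q) ≠ 0 := fun q => by
    rw [hP]
    exact smul_ne_zero (hsc q) (hΞ q)
  let pt : ℚ → ConicPts (Phi6 (-A) (-B) (-C) D 0 0) := fun q => ⟨P q, hPne q, by
    rw [hP]
    simp [Phi6, XiOf]
    ring⟩
  rw [lambdaPhi, dif_pos (hΞ ξ)]
  have hcont : Continuous fun x : ℝ => Projectivization.mk ℝ (XiOf A B C D x) (hΞ x) := by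
    have h1 : Continuous (Projectivization.mk' ℝ : {v : V3 // v ≠ 0} → ℙ ℝ V3) :=
      continuous_coinduced_rng
    have h2 : Continuous (XiOf A B C D) := by
      refine continuous_pi fun i => ?_
      fin_cases i <;> simp [XiOf] <;> fun_prop
    exact h1.comp (h2.subtype_mk hΞ)
  have hlim : Tendsto pt (ratNhds ξ)
      (comap (fun P : ConicPts (Phi6 (-A) (-B) (-C) D 0 0) =>
        Projectivization.mk ℝ (intCast3 P.1) P.2.1) (𝓝 (Projectivization.mk ℝ _ (hΞ ξ)))) := by
    rw [tendsto_comap_iff]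
    refine (tendsto_ratNhds_comp hcont.continuousAt).congr fun q => ?_
    refine ((Projectivization.mk_eq_mk_iff' _ _ _ _ _).2 ⟨_, (hP q).symm⟩).symm
  have hr := (tendsto_tangent_ratio hL).inv₀ one_ne_zero
  rw [inv_one] at hr
  refine limsup_le_of_ratio hr hlim ?_
  have hc : ContinuousAt (fun y : ℝ => α * y + β) ξ := by fun_prop
  filter_upwards [(tendsto_ratNhds_comp hc).eventually_ne hL] with q hq
  have hqn : (q.num : ℝ) = q * q.den := by exact_mod_cast (Rat.mul_den_eq_num q).symm
  have hval := hbil (conicContent A B C D q.num q.den : ℝ)⁻¹ q.num q.den (intCast3 (P q))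
    (by simp [hP, XiOf, hqn]; ring) (by simp [hP, XiOf, hqn]; ring)
    (by simp [hP, XiOf, hqn]; ring)
  change _ ≤ _ * ENNReal.ofReal (_ / |bil _ Sg (intCast3 (P q))|)
  rw [hval, hsqrt, abs_mul, abs_binary_form, weightedQuality,
    ← ENNReal.ofReal_mul (by positivity), abs_inv, Nat.abs_cast]
  refine (congrArg ENNReal.ofReal ?_).le
  have hL' := abs_ne_zero.2 hL
  have hq' := abs_ne_zero.2 hq
  have hgq := hg q
  generalize |α * ξ + β| = L at *
  generalize |α * (q : ℝ) + β| = M at *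
  field_simp

end Conic

/-- The content of the point of the conic with parameter `q`, together with the residues of the
numerator and denominator of `q` modulo it. -/
def residueKey (A B C D : ℤ) (q : ℚ) : ℤ × ℤ × ℤ :=
  (conicContent A B C D q.num q.den, q.num % conicContent A B C D q.num q.den,
    (q.den : ℤ) % conicContent A B C D q.num q.den)

theorem finite_range_residueKey {A B C D : ℤ} (hC : C ≠ 0) (hD : D ≠ 0) :
    (Set.range (residueKey A B C D)).Finite := by
  refine ((Set.finite_Icc 0 |C * D|).prod
    ((Set.finite_Icc 0 |C * D|).prod (Set.finite_Icc 0 |C * D|))).subset ?_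
  rintro _ ⟨q, rfl⟩
  have hpos : (0 : ℤ) < conicContent A B C D q.num q.den := by
    exact_mod_cast conicContent_pos hC hD (by simp)
  have hle : (conicContent A B C D q.num q.den : ℤ) ≤ |C * D| :=
    Int.le_of_dvd (abs_pos.2 (mul_ne_zero hC hD))
      ((dvd_abs _ _).2 (conicContent_dvd_mul (Rat.isCoprime_num_den q)))
  exact ⟨⟨hpos.le, hle⟩,
    ⟨Int.emod_nonneg _ hpos.ne', (Int.emod_lt_of_pos _ hpos).le.trans hle⟩,
    ⟨Int.emod_nonneg _ hpos.ne', (Int.emod_lt_of_pos _ hpos).le.trans hle⟩⟩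

theorem mem_span_of_residueKey_eq {A B C D x y : ℤ} {q q₀ : ℚ}
    (hxy : x * q₀.num + y * q₀.den = 1) (h : residueKey A B C D q = residueKey A B C D q₀) :
    ![q.num, (q.den : ℤ)] ∈ Submodule.span ℤ {![q₀.num, (q₀.den : ℤ)],
      ![-((conicContent A B C D q₀.num q₀.den : ℤ) * y),
        (conicContent A B C D q₀.num q₀.den : ℤ) * x]} ∧
    (conicContent A B C D q.num q.den : ℤ) =
      |![q₀.num, (q₀.den : ℤ)] 0 * ![-((conicContent A B C D q₀.num q₀.den : ℤ) * y),
          (conicContent A B C D q₀.num q₀.den : ℤ) * x] 1 -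
        ![q₀.num, (q₀.den : ℤ)] 1 * ![-((conicContent A B C D q₀.num q₀.den : ℤ) * y),
          (conicContent A B C D q₀.num q₀.den : ℤ) * x] 0| := by
  simp only [residueKey, Prod.mk.injEq] at h
  obtain ⟨hc, hs, ht⟩ := h
  rw [hc] at hs ht
  rw [mem_span_iff_dvd_det hxy, hc]
  constructor
  · obtain ⟨a, ha⟩ := Int.ModEq.dvd hs
    obtain ⟨b, hb⟩ := Int.ModEq.dvd ht
    refine ⟨q₀.den * a - q₀.num * b, ?_⟩
    simp
    linear_combination (q₀.den : ℤ) * ha - q₀.num * hb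
  · have e : q₀.num * ((conicContent A B C D q₀.num q₀.den : ℤ) * x) -
        q₀.den * -((conicContent A B C D q₀.num q₀.den : ℤ) * y) =
        conicContent A B C D q₀.num q₀.den := by
      linear_combination (conicContent A B C D q₀.num q₀.den : ℤ) * hxy
    simp only [Matrix.cons_val_zero, Matrix.cons_val_one, e, Nat.abs_cast]

theorem exists_coords_of_bezout (ξ : ℝ) {n s t x y : ℤ} (hn : n ≠ 0)
    (hxy : x * s + y * t = 1) : ∃ S T : ℝ,
      S • castVec2 ![s, t] + T • castVec2 ![-(n * y), n * x] = ![ξ, 1] := by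
  have hn' : (n : ℝ) ≠ 0 := by exact_mod_cast hn
  have hxyR : (x : ℝ) * s + y * t = 1 := by exact_mod_cast hxy
  refine ⟨x * ξ + y, (s - t * ξ) / n, ?_⟩
  ext i
  fin_cases i <;> simp [castVec2] <;> field_simp
  · linear_combination ξ * hxyR
  · linear_combination hxyR

/-- Lemma 4.1(b): the Lagrange approximability of the point of the conic
`Φ_{A,B,C,D} = 0` with irrational parameter `ξ` is the supremum, over all primitive
`R_{A,B,C,D}`-invariant full-rank lattices `Λ ⊆ ℤ²` and all `ℤ`-bases `(u,w)` of `Λ`, of the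
classical approximability of the coordinate `S/T`, where `(ξ,1) = S·u + T·w`. -/
theorem stmt13 (A B C D : ℤ) (hC : 1 ≤ C) (hD : 1 ≤ D) (ξ : ℝ) (hξ : Irrational ξ)
    (Sg : V3)
    (hperp : bil (Phi6 (-A) (-B) (-C) D 0 0) Sg (XiOf A B C D ξ) = 0)
    (hnprop : ∀ c : ℝ, Sg ≠ c • XiOf A B C D ξ) :
    lambdaPhi (Phi6 (-A) (-B) (-C) D 0 0) ((C : ℝ) * (D : ℝ) ^ 2) (XiOf A B C D ξ) Sg =
      ⨆ (Λ : Submodule ℤ (Fin 2 → ℤ)) (_ : Λ.toAddSubgroup.index ≠ 0)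
        (_ : PrimLat Λ) (_ : RInvariant A B C D Λ)
        (u : Fin 2 → ℤ) (w : Fin 2 → ℤ) (_ : Submodule.span ℤ {u, w} = Λ)
        (S : ℝ) (T : ℝ) (_ : S • castVec2 u + T • castVec2 w = ![ξ, 1]),
        lambdaCl (S / T) := by
  have hC0 : C ≠ 0 := by lia
  have hD0 : D ≠ 0 := by lia
  apply le_antisymm
  · refine (lambdaPhi_le_limsup_weightedQuality hC hD hξ hperp hnprop).trans ?_
    refine limsup_le_of_finite_cover (residueKey A B C D) (finite_range_residueKey hC0 hD0)
      fun q₀ => ?_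
    obtain ⟨x, y, hxy⟩ := Rat.isCoprime_num_den q₀
    have hn := (conicContent_pos (A := A) (B := B) (s := q₀.num) (t := q₀.den) hC0 hD0
      (by simp)).ne'
    have hn' : (conicContent A B C D q₀.num q₀.den : ℤ) ≠ 0 := by exact_mod_cast hn
    obtain ⟨S, T, hST⟩ := exists_coords_of_bezout ξ hn' hxy
    refine (limsup_weightedQuality_le_lambdaCl hξ hST fun q hq =>
      mem_span_of_residueKey_eq hxy hq).trans ?_
    refine le_iSup_of_le _ <| le_iSup_of_le (index_span_ne_zero hn' hxy) <|
      le_iSup_of_le (primLat_of_mem (Rat.isCoprime_num_den q₀)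
        (Submodule.subset_span (Set.mem_insert _ _))) <|
      le_iSup_of_le (rInvariant_span hxy) <| le_iSup_of_le _ <| le_iSup_of_le _ <|
      le_iSup_of_le rfl <| le_iSup_of_le S <| le_iSup_of_le T <| le_iSup_of_le hST le_rfl
  · refine le_trans ?_ (limsup_weightedQuality_le_lambdaPhi hC hD hperp hnprop)
    simp only [iSup_le_iff]
    rintro Λ - - hR u w rfl S T hST
    exact lambdaCl_le_limsup_weightedQuality hC0 hD0 hξ hR hST

end
end

section
/- Let A, B, C, D be integers with C ≥ 1 and D ≥ 1, let Φ = Φ_{A,B,C,D} and R = R_{A,B,C,D}. Let ξ ≠ ξ' be irrational real numbers, and set Ξ = (D·ξ², D·ξ, A·ξ² + B·ξ + C), Ξ' = (D·ξ'², D·ξ', A·ξ'² + B·ξ' + C). For every primitive R-invariant full-rank lattice Λ ⊆ ℤ² and every ℤ-basis (u,w) of Λ, write (ξ,1) = S·u + T·w and (ξ',1) = S'·u + T'·w with real S,T,S',T' (then T,T' ≠ 0), and set ξ_{Λ,u,w} = S/T, ξ'_{Λ,u,w} = S'/T'. Then for every nonzero Σ ∈ ℝ³ with ⟨Σ,Ξ⟩_Φ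 = ⟨Σ,Ξ'⟩_Φ = 0 (such Σ satisfies Φ(Σ) < 0): μ_Φ(Σ) equals the supremum, over all primitive R-invariant full-rank lattices Λ ⊆ ℤ² and all ℤ-bases (u,w) of Λ, of μ(ξ_{Λ,u,w}, ξ'_{Λ,u,w}), where μ(η,η') = sup_{(s,t) ∈ ℤ²∖{(0,0)}} |η − η'|/|(s − t·η)(s − t·η')|. -/
noncomputable section
open Filter Topology
open scoped ENNReal LinearAlgebra.Projectivization

/-- The homogeneous parametrization of the conic `Φ_{A,B,C,D} = 0`. -/
def conicParam (A B C D s t : ℝ) : V3 :=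
  ![D * s ^ 2, D * s * t, A * s ^ 2 + B * s * t + C * t ^ 2]

lemma Irrational.sub_int_mul_ne_zero {ξ : ℝ} (hξ : Irrational ξ) {m n : ℤ}
    (h : m ≠ 0 ∨ n ≠ 0) : (m : ℝ) - n * ξ ≠ 0 := by
  intro h0
  by_cases hn : n = 0
  · subst hn
    have hm : (m : ℝ) = 0 := by simpa using h0
    exact h.elim (fun h => h (by exact_mod_cast hm)) (fun h => h rfl)
  · exact ((hξ.intCast_mul hn).ne_int m) (by linarith)

lemma exists_dvd_and_eq_combination (a b c : ℤ) :
    ∃ g : ℕ, (g : ℤ) ∣ a ∧ (g : ℤ) ∣ b ∧ (g : ℤ) ∣ c ∧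
      ∃ x y z : ℤ, (g : ℤ) = x * a + y * b + z * c := by
  refine ⟨Int.gcd (Int.gcd a b) c, ?_, ?_, Int.gcd_dvd_right _ _, ?_⟩
  · exact (Int.gcd_dvd_left _ _).trans (Int.gcd_dvd_left _ _)
  · exact (Int.gcd_dvd_left _ _).trans (Int.gcd_dvd_right _ _)
  · refine ⟨Int.gcdA a b * Int.gcdA (Int.gcd a b) c, Int.gcdB a b * Int.gcdA (Int.gcd a b) c,
      Int.gcdB (Int.gcd a b) c, ?_⟩
    have h1 := Int.gcd_eq_gcd_ab a b
    have h2 := Int.gcd_eq_gcd_ab (Int.gcd a b) c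
    rw [h2]
    nth_rewrite 1 [h1]
    ring

/-- If `Σ` is orthogonal to the points of parameters `ξ` and `ξ'`, then `⟨Σ, ·⟩` pulls back along
the parametrization to a multiple `a (s - t ξ) (s - t ξ')`, whose discriminant is `-Δ Φ(Σ)`. -/
lemma exists_bil_conicParam_eq {A B C D : ℤ} (hC : 1 ≤ C) (hD : 1 ≤ D) {ξ ξ' : ℝ} (hne : ξ ≠ ξ')
    {Sg : V3} (hSg : Sg ≠ 0)
    (hperp : bil (Phi6 (-A) (-B) (-C) D 0 0) Sg (XiOf A B C D ξ) = 0)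
    (hperp' : bil (Phi6 (-A) (-B) (-C) D 0 0) Sg (XiOf A B C D ξ') = 0) :
    ∃ a : ℝ, a ≠ 0 ∧
      a ^ 2 * (ξ - ξ') ^ 2 = -((C : ℝ) * (D : ℝ) ^ 2 * Phi6 (-A) (-B) (-C) D 0 0 Sg) ∧
      ∀ (P : V3) (e f s t : ℝ), e • P = f • conicParam A B C D s t →
        e * bil (Phi6 (-A) (-B) (-C) D 0 0) Sg P = f * (a * ((s - t * ξ) * (s - t * ξ'))) := by
  have hC0 : (C : ℝ) ≠ 0 := by exact_mod_cast (by omega : C ≠ 0)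
  have hD0 : (D : ℝ) ≠ 0 := by exact_mod_cast (by omega : D ≠ 0)
  obtain ⟨a, ha⟩ : ∃ a : ℝ, a = D / 2 * (-A * Sg 0 - B * Sg 1 + D * Sg 2) := ⟨_, rfl⟩
  have h1 : a * ξ ^ 2 - C * D * Sg 1 * ξ + D * C * Sg 0 / 2 = 0 := by
    rw [← hperp, ha]
    simp [bil, Phi6, XiOf]
    ring
  have h2 : a * ξ' ^ 2 - C * D * Sg 1 * ξ' + D * C * Sg 0 / 2 = 0 := by
    rw [← hperp', ha]
    simp [bil, Phi6, XiOf]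
    ring
  have hb : C * D * Sg 1 = a * (ξ + ξ') := by
    apply mul_left_cancel₀ (sub_ne_zero.mpr hne)
    linear_combination h2 - h1
  have hc : D * C * Sg 0 / 2 = a * ξ * ξ' := by
    linear_combination h1 + ξ * hb
  refine ⟨a, ?_, ?_, ?_⟩
  · rintro rfl
    apply hSg
    have hy : Sg 1 = 0 := by
      have : C * D * Sg 1 = 0 := by simpa using hb
      simpa [hC0, hD0] using this
    have hx : Sg 0 = 0 := by
      have : D * C * Sg 0 / 2 = 0 := by simpa using hc
      simpa [hC0, hD0] using this
    have hz : Sg 2 = 0 := by simpa [hx, hy, hD0] using ha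
    ext i
    fin_cases i <;> simpa
  · have : a ^ 2 * (ξ - ξ') ^ 2 = (C * D * Sg 1) ^ 2 - 4 * a * (D * C * Sg 0 / 2) := by
      rw [hb, hc]; ring
    rw [this, ha]
    simp only [Phi6]
    push_cast
    ring
  · intro P e f s t h
    have h0 := congrFun h 0
    have h1 := congrFun h 1
    have h2 := congrFun h 2
    simp [conicParam] at h0 h1 h2
    have : a * ((s - t * ξ) * (s - t * ξ')) =
        a * s ^ 2 - C * D * Sg 1 * s * t + D * C * Sg 0 / 2 * t ^ 2 := by
      rw [hb, hc]; ring
    rw [this, ha]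
    simp [bil, Phi6]
    linear_combination (-A * Sg 0 - B / 2 * Sg 1 + D / 2 * Sg 2) * h0 +
      (-B / 2 * Sg 0 - C * Sg 1) * h1 + D / 2 * Sg 0 * h2

/-- If `(ξ, 1) = S u + T w` with `ξ` irrational, then `det (u, w)` and `T` are nonzero, and the linear
form `m - n ξ` at `(m, n) = p u + q w` is `det (u, w) T (p - q S / T)`. -/
lemma Irrational.coords_ne_zero {ξ : ℝ} (hξ : Irrational ξ) {u w : Fin 2 → ℤ} {S T : ℝ}
    (h : S • castVec2 u + T • castVec2 w = ![ξ, 1]) :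
    u 0 * w 1 - u 1 * w 0 ≠ 0 ∧ T ≠ 0 ∧
      ∀ p q : ℤ, ((p * u 0 + q * w 0 : ℤ) : ℝ) - (p * u 1 + q * w 1 : ℤ) * ξ =
        (u 0 * w 1 - u 1 * w 0 : ℤ) * T * (p - q * (S / T)) := by
  have h0 := congrFun h 0
  have h1 := congrFun h 1
  simp [castVec2] at h0 h1
  have hu : (u 0 : ℝ) - u 1 * ξ = (u 0 * w 1 - u 1 * w 0 : ℤ) * T := by
    push_cast; linear_combination -(u 0 : ℝ) * h1 + (u 1 : ℝ) * h0
  have hw : (w 0 : ℝ) - w 1 * ξ = -((u 0 * w 1 - u 1 * w 0 : ℤ) * S) := by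
    push_cast; linear_combination -(w 0 : ℝ) * h1 + (w 1 : ℝ) * h0
  have key : ((u 0 * w 1 - u 1 * w 0 : ℤ) : ℝ) * T ≠ 0 := by
    intro hz
    have hu0 : ¬ (u 0 ≠ 0 ∨ u 1 ≠ 0) := fun hh => hξ.sub_int_mul_ne_zero hh (hu.trans hz)
    push Not at hu0
    have hw0 : ¬ (w 0 ≠ 0 ∨ w 1 ≠ 0) := fun hh =>
      hξ.sub_int_mul_ne_zero hh (by rw [hw]; simp [hu0])
    push Not at hw0
    simp [hu0, hw0] at h1
  have hT : T ≠ 0 := right_ne_zero_of_mul key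
  refine ⟨by exact_mod_cast left_ne_zero_of_mul key, hT, fun p q => ?_⟩
  have : (u 0 * w 1 - u 1 * w 0 : ℤ) * T * (p - q * (S / T)) =
      p * ((u 0 * w 1 - u 1 * w 0 : ℤ) * T) - q * ((u 0 * w 1 - u 1 * w 0 : ℤ) * S) := by
    field_simp
  rw [this]
  push_cast at hu hw ⊢
  linear_combination (p : ℝ) * hu + (q : ℝ) * hw

/-- The Markoff quotient of the coordinates in a basis, in terms of the original pair. -/
lemma markoff_quotient_coords {ξ ξ' : ℝ} (hξ : Irrational ξ) (hξ' : Irrational ξ')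
    {u w : Fin 2 → ℤ} {S T S' T' : ℝ}
    (h : S • castVec2 u + T • castVec2 w = ![ξ, 1])
    (h' : S' • castVec2 u + T' • castVec2 w = ![ξ', 1]) (p q : ℤ) :
    |S / T - S' / T'| / |((p : ℝ) - q * (S / T)) * ((p : ℝ) - q * (S' / T'))| =
      |ξ - ξ'| * |((u 0 * w 1 - u 1 * w 0 : ℤ) : ℝ)| /
        |(((p * u 0 + q * w 0 : ℤ) : ℝ) - (p * u 1 + q * w 1 : ℤ) * ξ) *
          (((p * u 0 + q * w 0 : ℤ) : ℝ) - (p * u 1 + q * w 1 : ℤ) * ξ')| := by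
  obtain ⟨hd, hT, hpq⟩ := hξ.coords_ne_zero h
  obtain ⟨-, hT', hpq'⟩ := hξ'.coords_ne_zero h'
  rw [hpq, hpq']
  have hd' : ((u 0 * w 1 - u 1 * w 0 : ℤ) : ℝ) ≠ 0 := by exact_mod_cast hd
  have hdiff : ξ - ξ' = (u 0 * w 1 - u 1 * w 0 : ℤ) * T * T' * (S / T - S' / T') := by
    have h0 := congrFun h 0
    have h1 := congrFun h 1
    have h0' := congrFun h' 0
    have h1' := congrFun h' 1
    simp [castVec2] at h0 h1 h0' h1'
    have : (u 0 * w 1 - u 1 * w 0 : ℤ) * T * T' * (S / T - S' / T') =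
        (u 0 * w 1 - u 1 * w 0 : ℤ) * (S * T' - S' * T) := by
      field_simp
    rw [this]
    push_cast
    linear_combination -(S' * u 1 + T' * w 1) * h0 + (S * u 1 + T * w 1) * h0' - ξ * h1' + ξ' * h1
  generalize ((u 0 * w 1 - u 1 * w 0 : ℤ) : ℝ) = d at *
  rw [hdiff]
  have hsplit : d * T * (p - q * (S / T)) * (d * T' * (p - q * (S' / T'))) =
    (d * T * T' * d) * ((p - q * (S / T)) * (p - q * (S' / T'))) := by ring
  rw [hsplit, abs_mul (d * T * T' * d), abs_mul (d * T * T'), abs_mul (d * T * T') d]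
  have hne : |d * T * T'| * |d| ≠ 0 := by positivity
  rw [mul_right_comm, mul_div_mul_left _ _ hne]

lemma RInvariant.dvd_conicParam {A B C D : ℤ} {u w : Fin 2 → ℤ}
    (hΛ : RInvariant A B C D (Submodule.span ℤ {u, w})) {v : Fin 2 → ℤ}
    (hv : v ∈ Submodule.span ℤ {u, w}) :
    (u 0 * w 1 - u 1 * w 0) ∣ D * v 0 ^ 2 ∧ (u 0 * w 1 - u 1 * w 0) ∣ D * v 0 * v 1 ∧
      (u 0 * w 1 - u 1 * w 0) ∣ A * v 0 ^ 2 + B * v 0 * v 1 + C * v 1 ^ 2 := by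
  have hdet : ∀ y ∈ Submodule.span ℤ {u, w}, (u 0 * w 1 - u 1 * w 0) ∣ v 0 * y 1 - v 1 * y 0 := by
    intro y hy
    obtain ⟨a, b, rfl⟩ := Submodule.mem_span_pair.mp hv
    obtain ⟨c, d, rfl⟩ := Submodule.mem_span_pair.mp hy
    exact ⟨a * d - b * c, by simp; ring⟩
  have h1 := hdet _ (hΛ !![0, 0; D, 0] (Submodule.subset_span (by simp)) v hv)
  have h2 := hdet _ (hΛ !![0, 0; 0, D] (Submodule.subset_span (by simp)) v hv)
  have h3 := hdet _ (hΛ !![B, C; -A, 0] (Submodule.subset_span (by simp)) v hv)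
  simp [Matrix.mulVec, dotProduct, Fin.sum_univ_two] at h1 h2 h3
  refine ⟨?_, ?_, ?_⟩
  · convert h1 using 1; ring
  · convert h2 using 1; ring
  · obtain ⟨k, hk⟩ := h3
    exact ⟨-k, by linear_combination -hk⟩

/-- For coprime `(s, t)`, there is a primitive invariant lattice containing `(s, t)` whose index is
any prescribed common divisor `g > 0` of the coordinates of the conic point of parameter `(s, t)`. -/
lemma exists_primitive_invariant_lattice {A B C D s t : ℤ} (hst : IsCoprime s t) {g : ℕ}
    (hg : g ≠ 0) (h1 : (g : ℤ) ∣ D * s ^ 2) (h2 : (g : ℤ) ∣ D * s * t)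
    (h3 : (g : ℤ) ∣ A * s ^ 2 + B * s * t + C * t ^ 2) :
    ∃ u w : Fin 2 → ℤ, u 0 = s ∧ u 1 = t ∧ u 0 * w 1 - u 1 * w 0 = g ∧
      (Submodule.span ℤ {u, w}).toAddSubgroup.index ≠ 0 ∧
      PrimLat (Submodule.span ℤ {u, w}) ∧ RInvariant A B C D (Submodule.span ℤ {u, w}) := by
  obtain ⟨a, b, hab⟩ := hst
  have mem_iff : ∀ v : Fin 2 → ℤ, v ∈ Submodule.span ℤ {![s, t], ![-(g * b), g * a]} ↔
      (g : ℤ) ∣ s * v 1 - t * v 0 := by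
    intro v
    rw [Submodule.mem_span_pair]
    constructor
    · rintro ⟨x, y, rfl⟩
      exact ⟨y, by simp; linear_combination (g : ℤ) * y * hab⟩
    · rintro ⟨k, hk⟩
      refine ⟨a * v 0 + b * v 1, k, ?_⟩
      ext i
      fin_cases i
      · simp; linear_combination v 0 * hab + b * hk
      · simp; linear_combination v 1 * hab - a * hk
  refine ⟨![s, t], ![-(g * b), g * a], rfl, rfl, ?_, ?_, ?_, ?_⟩
  · simp; linear_combination (g : ℤ) * hab
  · have : NeZero g := ⟨hg⟩
    let φ : (Fin 2 → ℤ) →+ ZMod g :=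
      { toFun := fun v => ((s * v 1 - t * v 0 : ℤ) : ZMod g)
        map_zero' := by simp
        map_add' := fun v v' => by simp; ring }
    have hker : (Submodule.span ℤ {![s, t], ![-(g * b), g * a]}).toAddSubgroup = φ.ker := by
      ext v
      rw [Submodule.mem_toAddSubgroup, mem_iff, AddMonoidHom.mem_ker,
        ← ZMod.intCast_zmod_eq_zero_iff_dvd]
      rfl
    rw [hker, AddSubgroup.index_ker]
    exact Nat.card_pos.ne'
  · intro p hp
    refine ⟨![s, t], Submodule.subset_span (by simp), ?_⟩
    by_contra! h
    have h0 : (p : ℤ) ∣ s := h 0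
    have h1 : (p : ℤ) ∣ t := h 1
    have : (p : ℤ) ∣ 1 := hab ▸ dvd_add (h0.mul_left a) (h1.mul_left b)
    exact hp.one_lt.ne' (by exact_mod_cast Int.eq_one_of_dvd_one (by positivity) this)
  · intro M hM v hv
    have hMu : M.mulVec ![s, t] ∈ Submodule.span ℤ {![s, t], ![-(g * b), g * a]} := by
      induction hM using Submodule.span_induction with
      | mem M hM =>
        rw [mem_iff]
        rcases hM with rfl | rfl | rfl | rfl
        · simp [mul_comm]
        · obtain ⟨k, hk⟩ := h3
          refine ⟨-k, ?_⟩
          simp [Matrix.mulVec, dotProduct, Fin.sum_univ_two]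
          linear_combination -hk
        · convert h2 using 1
          simp [Matrix.mulVec, dotProduct, Fin.sum_univ_two]; ring
        · convert h1 using 1
          simp [Matrix.mulVec, dotProduct, Fin.sum_univ_two]; ring
      | zero => simp
      | add M M' _ _ h h' => rw [Matrix.add_mulVec]; exact add_mem h h'
      | smul x M _ h => rw [Matrix.smul_mulVec]; exact Submodule.smul_mem _ _ h
    obtain ⟨x, y, rfl⟩ := Submodule.mem_span_pair.mp hv
    rw [Matrix.mulVec_add, Matrix.mulVec_smul, Matrix.mulVec_smul]
    refine add_mem (Submodule.smul_mem _ _ hMu) (Submodule.smul_mem _ _ ?_)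
    rw [mem_iff]
    exact ⟨s * (-(M 1 0 * b) + M 1 1 * a) - t * (-(M 0 0 * b) + M 0 1 * a), by
      simp [Matrix.mulVec, dotProduct, Fin.sum_univ_two]; ring⟩

/-- Every nonzero integer point of the conic is proportional to a point with coprime integer
parameters. -/
lemma exists_coprime_parameter {A B C D : ℤ} (hC : 1 ≤ C) (hD : 1 ≤ D) {X Y Z : ℤ}
    (hP : X ≠ 0 ∨ Y ≠ 0 ∨ Z ≠ 0) (hΦ : D * X * Z = A * X ^ 2 + B * X * Y + C * Y ^ 2) :
    ∃ s t e f : ℤ, IsCoprime s t ∧ e ≠ 0 ∧ f ≠ 0 ∧ e * X = f * (D * s ^ 2) ∧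
      e * Y = f * (D * s * t) ∧ e * Z = f * (A * s ^ 2 + B * s * t + C * t ^ 2) := by
  by_cases hX : X = 0
  · subst hX
    have hY : Y = 0 := by
      have : C * Y ^ 2 = 0 := by linarith
      simpa [show C ≠ 0 by omega] using this
    exact ⟨0, 1, C, Z, isCoprime_one_right, by omega, by simpa [hY] using hP, by simp, by simp [hY],
      by ring⟩
  · have hpos : 0 < Int.gcd X Y := Int.gcd_pos_of_ne_zero_left _ hX
    obtain ⟨s, t, hst, hs, ht⟩ := Int.exists_gcd_one hpos
    generalize ((Int.gcd X Y : ℕ) : ℤ) = g at hs ht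
    have hg : g ≠ 0 := by rintro rfl; simp at hs; exact hX hs
    have hs0 : s ≠ 0 := by rintro rfl; simp at hs; exact hX hs
    refine ⟨s, t, D * s ^ 2, X, Int.isCoprime_iff_gcd_eq_one.mpr hst,
      mul_ne_zero (by omega) (pow_ne_zero _ hs0), hX, by ring, ?_, ?_⟩
    · subst hs ht; ring
    · apply mul_left_cancel₀ hg
      subst hs ht
      linear_combination s * hΦ

/-- Lemma 4.1(a): the Markoff approximability of the pair of points of the
conic `Φ_{A,B,C,D} = 0` with distinct irrational parameters `ξ, ξ'` is the supremum, over all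
primitive `R_{A,B,C,D}`-invariant full-rank lattices `Λ ⊆ ℤ²` and all `ℤ`-bases `(u,w)` of
`Λ`, of the classical Markoff approximability of the pair of coordinates `(S/T, S'/T')`,
where `(ξ,1) = S·u + T·w` and `(ξ',1) = S'·u + T'·w`.  (Moreover such `Σ` automatically
satisfies `Φ(Σ) < 0`.) -/
theorem stmt14 (A B C D : ℤ) (hC : 1 ≤ C) (hD : 1 ≤ D) (ξ ξ' : ℝ)
    (hξ : Irrational ξ) (hξ' : Irrational ξ') (hne : ξ ≠ ξ')
    (Sg : V3) (hSg : Sg ≠ 0)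
    (hperp : bil (Phi6 (-A) (-B) (-C) D 0 0) Sg (XiOf A B C D ξ) = 0)
    (hperp' : bil (Phi6 (-A) (-B) (-C) D 0 0) Sg (XiOf A B C D ξ') = 0) :
    Phi6 (-A) (-B) (-C) D 0 0 Sg < 0 ∧
    muPhi (Phi6 (-A) (-B) (-C) D 0 0) ((C : ℝ) * (D : ℝ) ^ 2) Sg =
      ⨆ (Λ : Submodule ℤ (Fin 2 → ℤ)) (_ : Λ.toAddSubgroup.index ≠ 0)
        (_ : PrimLat Λ) (_ : RInvariant A B C D Λ)
        (u : Fin 2 → ℤ) (w : Fin 2 → ℤ) (_ : Submodule.span ℤ {u, w} = Λ)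
        (S : ℝ) (T : ℝ) (_ : S • castVec2 u + T • castVec2 w = ![ξ, 1])
        (S' : ℝ) (T' : ℝ) (_ : S' • castVec2 u + T' • castVec2 w = ![ξ', 1]),
        muCl (S / T) (S' / T') := by
  obtain ⟨a, ha, hdisc, hbil⟩ := exists_bil_conicParam_eq hC hD hne hSg hperp hperp'
  have hC0 : (0 : ℝ) < C := by exact_mod_cast (by omega : 0 < C)
  have hD0 : (0 : ℝ) < D := by exact_mod_cast (by omega : 0 < D)
  have hpos : 0 < a ^ 2 * (ξ - ξ') ^ 2 := by
    have := sub_ne_zero.mpr hne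
    positivity
  have hneg : Phi6 (-A) (-B) (-C) D 0 0 Sg < 0 := by
    by_contra! h
    have : 0 ≤ (C : ℝ) * (D : ℝ) ^ 2 * Phi6 (-A) (-B) (-C) D 0 0 Sg := by positivity
    linarith
  have hsqrt : Real.sqrt ((C : ℝ) * (D : ℝ) ^ 2 * |Phi6 (-A) (-B) (-C) D 0 0 Sg|) =
      |a| * |ξ - ξ'| := by
    rw [abs_of_neg hneg, mul_neg, ← hdisc, ← mul_pow, Real.sqrt_sq_eq_abs, abs_mul]
  have hterm : ∀ (P : V3) (e f : ℝ) (s t : ℤ), e ≠ 0 → f ≠ 0 → (s ≠ 0 ∨ t ≠ 0) →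
      e • P = f • conicParam A B C D s t →
      bil (Phi6 (-A) (-B) (-C) D 0 0) Sg P ≠ 0 ∧
      Real.sqrt ((C : ℝ) * (D : ℝ) ^ 2 * |Phi6 (-A) (-B) (-C) D 0 0 Sg|) /
        |bil (Phi6 (-A) (-B) (-C) D 0 0) Sg P| =
      |ξ - ξ'| * |e / f| / |((s : ℝ) - t * ξ) * ((s : ℝ) - t * ξ')| := by
    intro P e f s t he hf hst h
    have h0 := mul_ne_zero (hξ.sub_int_mul_ne_zero hst) (hξ'.sub_int_mul_ne_zero hst)
    have hb := hbil P e f s t h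
    have hb' : bil (Phi6 (-A) (-B) (-C) D 0 0) Sg P =
        f * (a * (((s : ℝ) - t * ξ) * ((s : ℝ) - t * ξ'))) / e := by
      rw [← hb, mul_div_cancel_left₀ _ he]
    generalize ((s : ℝ) - t * ξ) * ((s : ℝ) - t * ξ') = r at *
    rw [hsqrt, hb']
    refine ⟨by positivity, ?_⟩
    simp only [abs_mul, abs_div]
    field_simp
  refine ⟨hneg, le_antisymm ?_ ?_⟩
  · refine iSup₂_le fun P hP => iSup₂_le fun hΦ _ => ?_
    have hP' : P 0 ≠ 0 ∨ P 1 ≠ 0 ∨ P 2 ≠ 0 := by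
      by_contra! h
      exact hP (by ext i; fin_cases i <;> simp [intCast3, h])
    have hΦ' : D * P 0 * P 2 = A * P 0 ^ 2 + B * P 0 * P 1 + C * P 1 ^ 2 := by
      simp [Phi6, intCast3] at hΦ
      have : (D * P 0 * P 2 : ℝ) = A * P 0 ^ 2 + B * P 0 * P 1 + C * P 1 ^ 2 := by linarith
      exact_mod_cast this
    obtain ⟨s, t, e, f, hst, he, hf, e0, e1, e2⟩ := exists_coprime_parameter hC hD hP' hΦ'
    have hst0 : s ≠ 0 ∨ t ≠ 0 := hst.ne_zero_or_ne_zero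
    obtain ⟨g, g0, g1, g2, x, y, z, hg⟩ := exists_dvd_and_eq_combination (D * s ^ 2) (D * s * t)
      (A * s ^ 2 + B * s * t + C * t ^ 2)
    have hg0 : g ≠ 0 := by
      rintro rfl
      have hs : s = 0 := by simpa [show D ≠ 0 by omega] using g0
      have ht : t = 0 := by simpa [hs, show C ≠ 0 by omega] using g2
      exact hst0.elim (fun h => h hs) (fun h => h ht)
    have hle : |(e : ℝ) / f| ≤ g := by
      have hfg : f * g = e * (x * P 0 + y * P 1 + z * P 2) := by
        rw [hg]; linear_combination -x * e0 - y * e1 - z * e2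
      have hdvd : |e| ≤ |f * g| := by
        apply Int.le_of_dvd (abs_pos.mpr (mul_ne_zero hf (by exact_mod_cast hg0)))
        exact (abs_dvd_abs _ _).mpr ⟨_, hfg⟩
      rw [abs_div, div_le_iff₀ (by positivity)]
      rw [abs_mul, Nat.abs_cast, mul_comm] at hdvd
      exact_mod_cast hdvd
    obtain ⟨u, w, hu0, hu1, hd, hind, hprim, hinv⟩ :=
      exists_primitive_invariant_lattice hst hg0 g0 g1 g2
    have hgR : ((u 0 * w 1 - u 1 * w 0 : ℤ) : ℝ) = g := by exact_mod_cast hd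
    have hgne : (u 0 * w 1 - u 1 * w 0 : ℝ) ≠ 0 := by
      have : (g : ℝ) ≠ 0 := by exact_mod_cast hg0
      rw [← hgR] at this; exact_mod_cast this
    have hcoord : ∀ η : ℝ, ∃ S T : ℝ, S • castVec2 u + T • castVec2 w = ![η, 1] := by
      intro η
      refine ⟨(η * w 1 - w 0) / (u 0 * w 1 - u 1 * w 0),
        (u 0 - η * u 1) / (u 0 * w 1 - u 1 * w 0), ?_⟩
      ext i
      fin_cases i
      · simp [castVec2]; rw [div_mul_eq_mul_div, div_mul_eq_mul_div, ← add_div, div_eq_iff hgne]; ring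
      · simp [castVec2]; rw [div_mul_eq_mul_div, div_mul_eq_mul_div, ← add_div, div_eq_iff hgne]; ring
    obtain ⟨S, T, hS⟩ := hcoord ξ
    obtain ⟨S', T', hS'⟩ := hcoord ξ'
    refine le_trans ?_ (le_iSup₂_of_le (Submodule.span ℤ {u, w}) hind <|
      le_iSup₂_of_le hprim hinv <| le_iSup₂_of_le u w <| le_iSup₂_of_le rfl S <|
      le_iSup₂_of_le T hS <| le_iSup₂_of_le S' T' <| le_iSup_of_le hS' <|
      le_iSup₂_of_le ((1, 0) : ℤ × ℤ) (by simp) le_rfl)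
    apply ENNReal.ofReal_le_ofReal
    have hq := markoff_quotient_coords hξ hξ' hS hS' 1 0
    simp only [one_mul, zero_mul, add_zero, hu0, hu1] at hq
    rw [hu0, hu1] at hgR
    rw [hq, hgR, Nat.abs_cast, (hterm _ e f s t (by exact_mod_cast he) (by exact_mod_cast hf) hst0 ?_).2]
    · gcongr
    · ext i
      fin_cases i
      · simp [intCast3, conicParam]; exact_mod_cast e0
      · simp [intCast3, conicParam]; exact_mod_cast e1
      · simp [intCast3, conicParam]; exact_mod_cast e2
  · refine iSup₂_le fun Λ _ => iSup₂_le fun _ hinv => iSup₂_le fun u w => iSup₂_le fun hspan S =>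
      iSup₂_le fun T hS => iSup₂_le fun S' T' => iSup_le fun hS' => iSup₂_le fun st hst => ?_
    subst hspan
    obtain ⟨p, q⟩ := st
    obtain ⟨hd, -, -⟩ := hξ.coords_ne_zero hS
    obtain ⟨⟨k0, h0⟩, ⟨k1, h1⟩, ⟨k2, h2⟩⟩ :=
      hinv.dvd_conicParam (Submodule.mem_span_pair.mpr ⟨p, q, rfl⟩)
    have hm0 : (p • u + q • w) 0 = p * u 0 + q * w 0 := by simp
    have hm1 : (p • u + q • w) 1 = p * u 1 + q * w 1 := by simp
    have hmn : p * u 0 + q * w 0 ≠ 0 ∨ p * u 1 + q * w 1 ≠ 0 := by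
      by_contra! h
      have hp : (u 0 * w 1 - u 1 * w 0) * p = 0 := by linear_combination w 1 * h.1 - w 0 * h.2
      have hq : (u 0 * w 1 - u 1 * w 0) * q = 0 := by linear_combination u 0 * h.2 - u 1 * h.1
      have hp : p = 0 := by simpa [hd] using hp
      have hq : q = 0 := by simpa [hd] using hq
      exact hst (by simp [hp, hq])
    rw [hm0, hm1] at h1 h2
    rw [hm0] at h0
    have hq := markoff_quotient_coords hξ hξ' hS hS' p q
    simp only [hq]
    generalize p * u 0 + q * w 0 = m at *
    generalize p * u 1 + q * w 1 = n at *
    generalize u 0 * w 1 - u 1 * w 0 = d at *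
    have hdR : (d : ℝ) ≠ 0 := by exact_mod_cast hd
    have hprop : (d : ℝ) • intCast3 ![k0, k1, k2] = (1 : ℝ) • conicParam A B C D m n := by
      ext i
      fin_cases i
      · simp [intCast3, conicParam]; exact_mod_cast h0.symm
      · simp [intCast3, conicParam]; exact_mod_cast h1.symm
      · simp [intCast3, conicParam]; exact_mod_cast h2.symm
    obtain ⟨hb, hval⟩ := hterm _ d 1 m n hdR one_ne_zero hmn hprop
    have hne0 : intCast3 ![k0, k1, k2] ≠ 0 := by
      intro h
      simp [h, bil, Phi6] at hb
    have hΦ0 : Phi6 (-A) (-B) (-C) D 0 0 (intCast3 ![k0, k1, k2]) = 0 := by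
      have : d ^ 2 * (D * k0 * k2 - (A * k0 ^ 2 + B * k0 * k1 + C * k1 ^ 2)) = 0 := by
        have : d ^ 2 * (D * k0 * k2 - (A * k0 ^ 2 + B * k0 * k1 + C * k1 ^ 2)) =
          D * (d * k0) * (d * k2) -
            (A * (d * k0) ^ 2 + B * (d * k0) * (d * k1) + C * (d * k1) ^ 2) := by ring
        rw [this, ← h0, ← h1, ← h2]; ring
      have : D * k0 * k2 - (A * k0 ^ 2 + B * k0 * k1 + C * k1 ^ 2) = 0 := by
        simpa [hd] using this
      have : (D * k0 * k2 - (A * k0 ^ 2 + B * k0 * k1 + C * k1 ^ 2) : ℝ) = 0 := by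
        exact_mod_cast this
      simp [Phi6, intCast3]
      linarith
    refine le_iSup₂_of_le ![k0, k1, k2] hne0 <| le_iSup₂_of_le hΦ0 hb ?_
    rw [hval, div_one]

end
end
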